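/- The number of isomorphism classes of left braces $(B,+,\cdot)$ with additive group $(B,+)$ isomorphic to $C_2\times C_2\times C_4\times C_4$ and multiplicative group $(B,\cdot)$ isomorphic to $C_4\times C_4\times C_4$ is $1\,054$. -/

import Mathlib

/-- A left brace structure on a set `B`: an abelian group operation `+` (with
zero element `zero` and negation `neg`), a group operation `*` (with identity
`one` and inversion `inv`), linked by the relation
`x * (y + z) = x * y - x + x * z`, i.e. `x * (y + z) = (x * y + (-x)) + x * z`. -/
structure LeftBrace (B : Type*) where
  add : B → B → B
  zero : B
  neg : B → B
  mul : B → B → B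
  one : B
  inv : B → B
  add_assoc : ∀ a b c, add (add a b) c = add a (add b c)
  add_comm : ∀ a b, add a b = add b a
  zero_add : ∀ a, add zero a = a
  neg_add_cancel : ∀ a, add (neg a) a = zero
  mul_assoc : ∀ a b c, mul (mul a b) c = mul a (mul b c)
  one_mul : ∀ a, mul one a = a
  mul_one : ∀ a, mul a one = a
  inv_mul_cancel : ∀ a, mul (inv a) a = one
  brace : ∀ x y z, mul x (add y z) = add (add (mul x y) (neg x)) (mul x z)

/-- Two left braces are isomorphic if there is a bijection preserving both
operations. -/
def LeftBrace.Iso {B₁ B₂ : Type*} (L₁ : LeftBrace B₁) (L₂ : LeftBrace B₂) : Prop :=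
  ∃ e : B₁ ≃ B₂, (∀ x y, e (L₁.add x y) = L₂.add (e x) (e y)) ∧
    (∀ x y, e (L₁.mul x y) = L₂.mul (e x) (e y))

/-- The additive group of the left brace `L` is isomorphic to the
(additively written) abelian group `A`. -/
def LeftBrace.AddIso {B : Type*} (L : LeftBrace B) (A : Type*) [AddGroup A] : Prop :=
  ∃ e : B ≃ A, ∀ x y, e (L.add x y) = e x + e y

/-- The multiplicative group of the left brace `L` is isomorphic to the
(additively written) group `A`. -/
def LeftBrace.MulIso {B : Type*} (L : LeftBrace B) (A : Type*) [AddGroup A] : Prop :=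
  ∃ e : B ≃ A, ∀ x y, e (L.mul x y) = e x + e y

/-! ### Vectors and matrices over the field with two elements -/

def V3 : Type := Bool × Bool × Bool

namespace V3

instance : DecidableEq V3 := inferInstanceAs (DecidableEq (Bool × Bool × Bool))
instance : Fintype V3 := inferInstanceAs (Fintype (Bool × Bool × Bool))

def vadd (x y : V3) : V3 := (xor x.1 y.1, xor x.2.1 y.2.1, xor x.2.2 y.2.2)
def vzero : V3 := (false, false, false)

instance : Add V3 := ⟨vadd⟩
instance : Zero V3 := ⟨vzero⟩
instance : Neg V3 := ⟨fun x => x⟩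

instance : AddCommGroup V3 where
  add_assoc := by decide
  zero_add := by decide
  add_zero := by decide
  add_comm := by decide
  neg_add_cancel := by decide
  nsmul := nsmulRec
  zsmul := zsmulRec

theorem add_self (x : V3) : x + x = 0 := by revert x; decide

/-- scalar multiplication -/
def sm (b : Bool) (v : V3) : V3 := cond b v 0

end V3

open V3

abbrev M3 : Type := V3 × V3 × V3

/-- apply a matrix, given by columns, to a vector -/
def ap (m : M3) (v : V3) : V3 := sm v.1 m.1 + sm v.2.1 m.2.1 + sm v.2.2 m.2.2

def mm (g h : M3) : M3 := (ap g h.1, ap g h.2.1, ap g h.2.2)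

def E1 : V3 := (true, false, false)
def E2 : V3 := (false, true, false)
def E3 : V3 := (false, false, true)

def cross (x y : V3) : V3 :=
  (xor (x.2.1 && y.2.2) (x.2.2 && y.2.1), xor (x.2.2 && y.1) (x.1 && y.2.2),
    xor (x.1 && y.2.1) (x.2.1 && y.1))

def tr (m : M3) : M3 :=
  ((m.1.1, m.2.1.1, m.2.2.1), (m.1.2.1, m.2.1.2.1, m.2.2.2.1), (m.1.2.2, m.2.1.2.2, m.2.2.2.2))

def adj (m : M3) : M3 := tr (cross m.2.1 m.2.2, cross m.2.2 m.1, cross m.1 m.2.1)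

def one3 : M3 := (E1, E2, E3)

/-- symmetric bilinear forms with values in `V3`: squares and mixed products of the basis -/
abbrev Bet : Type := M3 × M3

def bil (β : Bet) (x y : V3) : V3 :=
  sm (x.1 && y.1) β.1.1 + sm (x.2.1 && y.2.1) β.1.2.1 + sm (x.2.2 && y.2.2) β.1.2.2 +
  (sm (xor (x.1 && y.2.1) (x.2.1 && y.1)) β.2.1 +
   sm (xor (x.1 && y.2.2) (x.2.2 && y.1)) β.2.2.1 +
   sm (xor (x.2.1 && y.2.2) (x.2.2 && y.2.1)) β.2.2.2)

def actS (g h : M3) (s : M3) : M3 := mm g (mm s h)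
def actO (g h : M3) (β : Bet) : M3 :=
  (ap g (bil β h.1 h.2.1), ap g (bil β h.1 h.2.2), ap g (bil β h.2.1 h.2.2))

def cv (v : V3) : ℕ := 4 * cond v.1 1 0 + 2 * cond v.2.1 1 0 + cond v.2.2 1 0
def cm (m : M3) : ℕ := 64 * cv m.1 + 8 * cv m.2.1 + cv m.2.2

def allB : List Bool := [false, true]
def allV : List V3 := allB.flatMap fun a => allB.flatMap fun b => allB.map fun c => (a, b, c)
def allM : List M3 := allV.flatMap fun a => allV.flatMap fun b => allV.map fun c => (a, b, c)

def eqV (x y : V3) : Bool := x.1 == y.1 && (x.2.1 == y.2.1 && x.2.2 == y.2.2)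
def eqM (x y : M3) : Bool := eqV x.1 y.1 && (eqV x.2.1 y.2.1 && eqV x.2.2 y.2.2)

/-- evaluate a vector before passing it on -/
def fo (v : V3) (k : V3 → Bool) : Bool :=
  bif v.1 then
    bif v.2.1 then bif v.2.2 then k (true, true, true) else k (true, true, false)
    else bif v.2.2 then k (true, false, true) else k (true, false, false)
  else
    bif v.2.1 then bif v.2.2 then k (false, true, true) else k (false, true, false)
    else bif v.2.2 then k (false, false, true) else k (false, false, false)

def foM (m : M3) (k : M3 → Bool) : Bool :=
  fo m.1 fun a => fo m.2.1 fun b => fo m.2.2 fun c => k (a, b, c)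

theorem fo_eq (v : V3) (k : V3 → Bool) : fo v k = k v := by
  obtain ⟨a, b, c⟩ := v
  cases a <;> cases b <;> cases c <;> rfl

theorem foM_eq (m : M3) (k : M3 → Bool) : foM m k = k m := by
  simp only [foM, fo_eq]

def foS (g h s : M3) (k : M3 → Bool) : Bool := foM (mm s h) fun t => foM (mm g t) k

theorem foS_eq (g h s : M3) (k : M3 → Bool) : foS g h s k = k (actS g h s) := by
  simp only [foS, foM_eq]; rfl

def had (x y : V3) : V3 := (x.1 && y.1, x.2.1 && y.2.1, x.2.2 && y.2.2)
def crs (x y : V3) : V3 :=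
  (xor (x.1 && y.2.1) (x.2.1 && y.1), xor (x.1 && y.2.2) (x.2.2 && y.1),
    xor (x.2.1 && y.2.2) (x.2.2 && y.2.1))

def foB (g : M3) (β : Bet) (x y : V3) (k : V3 → Bool) : Bool :=
  fo (had x y) fun a => fo (ap β.1 a) fun a => fo (crs x y) fun b => fo (ap β.2 b) fun b =>
  fo (vadd a b) fun c => fo (ap g c) k

theorem foB_eq (g : M3) (β : Bet) (x y : V3) (k : V3 → Bool) :
    foB g β x y k = k (ap g (bil β x y)) := by
  simp only [foB, fo_eq]; rfl

def foO (g h : M3) (β : Bet) (k : M3 → Bool) : Bool :=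
  foB g β h.1 h.2.1 fun u => foB g β h.1 h.2.2 fun v => foB g β h.2.1 h.2.2 fun w => k (u, v, w)

theorem foO_eq (g h : M3) (β : Bet) (k : M3 → Bool) : foO g h β k = k (actO g h β) := by
  simp only [foO, foB_eq]; rfl

def glL : List (M3 × M3) :=
  (allM.filter fun g => foM g fun g => foM (adj g) fun h => foM (mm g h) fun u => eqM u one3).map fun g => (g, adj g)

/-- the doubling map `x ↦ x + x²` has a kernel of order two -/
def rk (s : M3) : Bool := Nat.beq (allV.countP fun v => eqV (ap s v) v) 2

def smin (s : M3) : Bool := foM s fun s => rk s && glL.all fun g => foM g.1 fun a =>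
  foM g.2 fun b => foS a b s fun t => Nat.ble (cm s) (cm t)
def cen (s : M3) : List (M3 × M3) := glL.filter fun g => foM s fun s => foM g.1 fun a =>
  foM g.2 fun b => foS a b s fun t => eqM t s
def omin (c : List (M3 × M3)) (s o : M3) : Bool := foM s fun s => foM o fun o =>
  c.all fun g => foM g.1 fun a => foM g.2 fun b => foO a b (s, o) fun t => Nat.ble (cm o) (cm t)

def cnt1 : ℕ := ((allM.filter smin).map fun s =>
  (fun c => allM.countP (omin c s)) (cen s)).sum

/-- clear the coefficients of `E2` in the first two mixed products -/
def nrm (o : M3) : M3 := ((o.1.1, false, o.1.2.2), (o.2.1.1, false, o.2.1.2.2), o.2.2)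

def wfS (s : M3) : Bool := s.1.1 && (!s.2.1.1 && (!s.2.2.1 && rk s))
def wfO (o : M3) : Bool :=
  (!o.1.1 && (!o.2.1.1 && !o.2.2.1)) && (!o.1.2.1 && !o.2.1.2.1)

def gl8 : List (M3 × M3) := glL.filter fun g =>
  eqV g.1.2.1 E2 && (g.1.1.1 && !g.1.2.2.1)

def cb (β : Bet) : ℕ := 512 * cm β.1 + cm β.2

def act2 (g h : M3) (β : Bet) : Bet := (actS g h β.1, nrm (actO g h β))

def ok2 (c : List (M3 × M3)) (β : Bet) : Bool :=
  foM β.1 fun s => foM β.2 fun o => c.all fun g => foM g.1 fun a => foM g.2 fun b =>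
  foS a b s fun s' => !wfS s' || foO a b (s, o) fun o' => foM (nrm o') fun o' =>
  (!wfO o' || Nat.ble (cb (s, o)) (cb (s', o')))

def cnt2 : ℕ := (fun S O c => (S.map fun s => O.countP fun o => ok2 c (s, o)).sum)
  (allM.filter wfS) (allM.filter wfO) gl8


/-! ### Structure of the radical ring -/

section RingTheory

variable {S : Type*} [CommRing S]

structure RH (I : Ideal S) : Prop where
  h4 : ∀ x ∈ I, 4 * x = 0
  h0 : ∀ x ∈ I, ∀ y ∈ I, x * y = y → y = 0
  hQ : ∀ x ∈ I, 2 * x + x * x = 0 ↔ ∃ y ∈ I, x = 2 * y + y * y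
  hz : ∃ z ∈ I, 2 * z + z * z = 0 ∧ (∀ y ∈ I, z ≠ 2 * y) ∧
    ∀ q ∈ I, 2 * q + q * q = 0 → (∃ y ∈ I, q = 2 * y) ∨ (∃ y ∈ I, q = z + 2 * y)
  hU : ∀ x ∈ I, ∀ y ∈ I, ∀ w ∈ I, 2 * x ≠ 0 → 2 * y ≠ 0 → 2 * x ≠ 2 * y →
    2 * w = 0 ∨ 2 * w = 2 * x ∨ 2 * w = 2 * y ∨ 2 * w = 2 * x + 2 * y

variable {I : Ideal S}

theorem RH.urr (H : RH I) {x y u : S} (hx : x ∈ I) (hy : y ∈ I) (hu : u ∈ I) :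
    x * y * (2 * u) = 0 := by
  by_contra hne
  have m1 : y * u ∈ I := I.mul_mem_left _ hu
  have m2 : x * y * u ∈ I := I.mul_mem_left _ hu
  have m3 : x * y ∈ I := I.mul_mem_left _ hy
  have m0 : 2 * u ∈ I := I.mul_mem_left _ hu
  have a1 : 2 * u ≠ 0 := by
    intro h; apply hne; rw [h, mul_zero]
  have a2 : 2 * (y * u) ≠ 0 := by
    intro h; apply hne; linear_combination x * h
  have a3 : 2 * u ≠ 2 * (y * u) := by
    intro h; apply a1; apply H.h0 y hy _ m0; linear_combination -h
  rcases H.hU u hu (y * u) m1 (x * y * u) m2 a1 a2 a3 with h | h | h | h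
  · apply hne; linear_combination h
  · apply a1; apply H.h0 (x * y) m3 _ m0; linear_combination h
  · apply a2; apply H.h0 x hx _ (I.mul_mem_left _ m1); linear_combination h
  · apply a1; apply H.h0 (x * y - y) (I.sub_mem m3 hy) _ m0; linear_combination h

structure RC (I : Ideal S) (N : S → Prop) (a : S) : Prop where
  ha : a ∈ I
  haN : ¬ N a
  hd : ∀ x ∈ I, N x ∨ ∃ n ∈ I, N n ∧ x = a + n
  h2 : ∀ x ∈ I, ∀ y ∈ I, 2 * (x * y) = 0
  h3 : ∀ x ∈ I, ∀ y ∈ I, ∀ n ∈ I, N n → x * y * n = 0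
  h4 : a * a * a * a = 0
  ht : ∃ y ∈ I, N y ∧ a * a * a = 2 * y + y * y
  hadd : ∀ x ∈ I, ∀ y ∈ I, N x → (N (x + y) ↔ N y)
  hmul : ∀ x ∈ I, ∀ y ∈ I, N (x * y)
  hker : ∀ x ∈ I, ∀ y ∈ I, 2 * (x * y) + x * y * (x * y) = 0

theorem RH.main (H : RH I) : ∃ N a, RC I N a := by
  obtain ⟨z, hzI, hz0, hzU, hzQ⟩ := H.hz
  obtain ⟨a, ha, hza⟩ := (H.hQ z hzI).1 hz0
  have haa : a * a ∈ I := I.mul_mem_left _ ha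
  -- every element of the kernel of the squaring map
  have Q : ∀ q ∈ I, 2 * q + q * q = 0 → (∃ y ∈ I, q = 2 * y) ∨ (∃ y ∈ I, q = a * a + 2 * y) := by
    intro q hq h
    rcases hzQ q hq h with h | ⟨y, hy, h⟩
    · exact Or.inl h
    · exact Or.inr ⟨a + y, I.add_mem ha hy, by rw [h, hza]; ring⟩
  have aaU : ∀ y ∈ I, a * a ≠ 2 * y := by
    intro y hy h
    exact hzU (a + y) (I.add_mem ha hy) (by rw [hza, h]; ring)
  have Q2 : ∀ x ∈ I, ∀ y ∈ I, 2 * (x + 2 * y) + (x + 2 * y) * (x + 2 * y) = 2 * x + x * x := by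
    intro x hx y hy
    have e1 := H.h4 y hy
    linear_combination (1 + x + y) * e1
  have th2 : ∀ x ∈ I, 2 * (x * x) + x * x * (x * x) = 0 := by
    intro x hx
    have hm : 2 * x + x * x ∈ I := I.add_mem (I.mul_mem_left _ hx) (I.mul_mem_left _ hx)
    have := (H.hQ _ hm).2 ⟨x, hx, rfl⟩
    have e1 := H.h4 x hx
    linear_combination this - (1 + x + x * x) * e1
  have sq : ∀ x ∈ I, (∃ y ∈ I, x * x = 2 * y) ∨ (∃ y ∈ I, x * x = a * a + 2 * y) := by
    intro x hx
    exact Q _ (I.mul_mem_left _ hx) (th2 x hx)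
  let N : S → Prop := fun x => ∃ y ∈ I, x * x = 2 * y
  have haN : ¬ N a := by
    rintro ⟨y, hy, h⟩; exact aaU y hy h
  have hd : ∀ x ∈ I, N x ∨ ∃ n ∈ I, N n ∧ x = a + n := by
    intro x hx
    rcases sq x hx with h | ⟨y, hy, h⟩
    · exact Or.inl h
    · refine Or.inr ⟨x - a, I.sub_mem hx ha, ⟨y - x * a + a * a, ?_, ?_⟩, by ring⟩
      · exact I.add_mem (I.sub_mem hy (I.mul_mem_left _ ha)) haa
      · linear_combination h
  -- step A
  have A : ∀ x ∈ I, ∀ n ∈ I, N n → 2 * (x * n) = 0 := by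
    rintro x hx n hn ⟨c, hc, hnc⟩
    by_contra hs
    have m : 2 * (x * n) ∈ I := I.mul_mem_left _ (I.mul_mem_left _ hn)
    have b1 : 2 * n ≠ 0 := by intro h; apply hs; linear_combination x * h
    have b2 : 2 * (x * n) ≠ 2 * n := by
      intro h; apply hs; apply H.h0 x hx _ m; linear_combination x * h
    have e := H.h4 c hc
    rcases H.hU (x * n) (I.mul_mem_left _ hn) n hn x hx hs b1 b2 with h | h | h | h
    · apply hs; linear_combination n * h
    · apply hs; apply H.h0 n hn _ m; linear_combination -n * h
    · apply hs; linear_combination n * h + 2 * hnc + e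
    · apply hs; apply H.h0 n hn _ m
      linear_combination -n * h - 2 * hnc - e
  -- step B
  have Bq : ∀ x ∈ I, ∀ n ∈ I, N n → 2 * (x * n) + (x * n) * (x * n) = 0 := by
    intro x hx n hn hN
    have e := A x hx n hn hN
    obtain ⟨c, hc, hnc⟩ := hN
    have e2 := H.urr hx hx hc
    linear_combination e + x * x * hnc + e2
  -- step C
  have C : 2 * (a * a) = 0 := by
    obtain ⟨n, hn, h⟩ := (H.hQ (2 * a) (I.mul_mem_left _ ha)).1 (by
      have := H.h4 a ha; linear_combination (1 + a) * this)
    have hN : N n := ⟨a - n, I.sub_mem ha hn, by linear_combination -h⟩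
    have e1 := A a ha n hn hN
    rcases Q _ (I.mul_mem_left a hn) (Bq a ha n hn hN) with ⟨r, hr, h2⟩ | ⟨r, hr, h2⟩
    · have e2 := A r hr n hn hN
      linear_combination a * h + e1 + n * h2 + e2
    · have e2 := A r hr n hn hN
      have e3 := H.urr ha ha hr
      have e4 := H.urr ha ha ha
      have e5 := th2 a ha
      have s1 : 2 * (a * a) = a * a * a + 2 * r * a := by
        linear_combination a * h + e1 + n * h2 + e2 + a * h2
      have s2 : a * a * a * a = 0 := by linear_combination -a * s1 + e4 - e3
      linear_combination e5 - s2
  have D : ∀ x ∈ I, ∀ y ∈ I, 2 * (x * y) = 0 := by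
    intro x hx y hy
    rcases hd x hx with h | ⟨n, hn, hN, rfl⟩
    · have := A y hy x hx h
      linear_combination this
    · rcases hd y hy with h | ⟨n', hn', hN', rfl⟩
      · exact A _ hx y hy h
      · have e1 := A a ha n' hn' hN'
        have e2 := A a ha n hn hN
        have e3 := A n hn n' hn' hN'
        linear_combination C + e1 + e2 + e3
  have U0 : ∀ x ∈ I, ∀ y ∈ I, (2 * x) * y = 0 := by
    intro x hx y hy; have := D x hx y hy; linear_combination this
  have a4 : a * a * a * a = 0 := by
    have := th2 a ha; linear_combination this - C
  -- products lie in the kernel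
  have P : ∀ x ∈ I, ∀ y ∈ I, (∃ w ∈ I, x * y = 2 * w) ∨ (∃ w ∈ I, x * y = a * a + 2 * w) := by
    intro x hx y hy
    have cl : ∀ p q : S, ((∃ w ∈ I, p = 2 * w) ∨ (∃ w ∈ I, p = a * a + 2 * w)) →
        ((∃ w ∈ I, q = 2 * w) ∨ (∃ w ∈ I, q = a * a + 2 * w)) →
        ((∃ w ∈ I, p + q = 2 * w) ∨ (∃ w ∈ I, p + q = a * a + 2 * w)) := by
      rintro p q (⟨w, hw, rfl⟩ | ⟨w, hw, rfl⟩) (⟨v, hv, rfl⟩ | ⟨v, hv, rfl⟩)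
      · exact Or.inl ⟨w + v, I.add_mem hw hv, by ring⟩
      · exact Or.inr ⟨w + v, I.add_mem hw hv, by ring⟩
      · exact Or.inr ⟨w + v, I.add_mem hw hv, by ring⟩
      · exact Or.inl ⟨w + v, I.add_mem hw hv, by linear_combination C⟩
    have PN : ∀ x ∈ I, ∀ n ∈ I, N n →
        (∃ w ∈ I, x * n = 2 * w) ∨ (∃ w ∈ I, x * n = a * a + 2 * w) := by
      intro x hx n hn hN
      exact Q _ (I.mul_mem_left _ hn) (Bq x hx n hn hN)
    rcases hd y hy with h | ⟨n', hn', hN', rfl⟩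
    · exact PN x hx y hy h
    · rcases hd x hx with h | ⟨n, hn, hN, rfl⟩
      · rw [mul_comm]; exact PN _ hy x hx h
      · have := cl _ _ (cl (a * a) (a * n) (Or.inr ⟨0, I.zero_mem, by ring⟩) (PN a ha n hn hN))
          (PN (a + n) hx n' hn' hN')
        have e : a * a + a * n + (a + n) * n' = (a + n) * (a + n') := by ring
        rwa [e] at this
  have aan : ∀ n ∈ I, N n → a * a * n = 0 := by
    rintro n hn ⟨c, hc, hnc⟩
    rcases P a ha n hn with ⟨w, hw, h⟩ | ⟨w, hw, h⟩
    · have := U0 w hw a ha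
      linear_combination a * h + this
    · have e1 := U0 w hw a ha
      have e2 := U0 w hw n hn
      have e3 := U0 c hc a ha
      linear_combination a * hnc + e3 - n * h - e2
  have hm : ∀ x ∈ I, ∀ y ∈ I, N (x * y) := by
    intro x hx y hy
    refine ⟨0, I.zero_mem, ?_⟩
    rcases P x hx y hy with ⟨w, hw, h⟩ | ⟨w, hw, h⟩
    · have := U0 w hw w hw
      rw [h]; linear_combination 2 * this
    · have := U0 w hw w hw
      have e2 := U0 w hw (a * a) haa
      rw [h]; linear_combination 2 * this + a4 + 2 * e2
  refine ⟨N, a, ha, haN, hd, D, ?_, a4, ?_, ?_, hm, ?_⟩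
  · intro x hx y hy n hn hN
    rcases P x hx y hy with ⟨w, hw, h⟩ | ⟨w, hw, h⟩
    · rw [h]; exact U0 w hw n hn
    · rw [h]; have := aan n hn hN; have e := U0 w hw n hn; linear_combination this + e
  · -- the cube of a
    have key : ∃ w ∈ I, a * a * a = 2 * w := by
      rcases P (a * a) haa a ha with h | ⟨w, hw, h⟩
      · exact h
      · exfalso
        have e := U0 w hw a ha
        have e1 : a * a * a = 0 := by linear_combination a4 - a * h - e
        exact aaU (-w) (I.neg_mem hw) (by linear_combination e1 - h)
    obtain ⟨w, hw, h⟩ := key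
    obtain ⟨y, hy, h2⟩ := (H.hQ (a * a * a) (I.mul_mem_left _ ha)).1 (by
      have := H.h4 w hw; rw [h]; linear_combination (1 + w) * this)
    exact ⟨y, hy, ⟨w - y, I.sub_mem hw hy, by linear_combination h - h2⟩, h2⟩
  · rintro x hx y hy ⟨c, hc, h⟩
    constructor
    · rintro ⟨d, hd, h2⟩
      refine ⟨d - c - x * y, I.sub_mem (I.sub_mem hd hc) (I.mul_mem_left _ hy), ?_⟩
      linear_combination h2 - h
    · rintro ⟨d, hd, h2⟩
      refine ⟨c + d + x * y, I.add_mem (I.add_mem hc hd) (I.mul_mem_left _ hy), ?_⟩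
      linear_combination h2 + h
  · intro x hx y hy
    obtain ⟨w, hw, h⟩ := hm x hx y hy
    have e := D x hx y hy
    have e3 := D (x) hx (y * (x * y)) (I.mul_mem_left _ (I.mul_mem_left _ hy))
    rcases P x hx y hy with ⟨w, hw, h⟩ | ⟨w, hw, h⟩
    · have := U0 w hw w hw
      linear_combination e + (x * y + 2 * w) * h + 2 * this
    · have := U0 w hw w hw
      have e2 := U0 w hw (a * a) haa
      linear_combination e + (x * y + a * a + 2 * w) * h + 2 * this + a4 + 2 * e2

end RingTheory


/-! ### The models on `C₄ × C₄ × C₄` -/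

abbrev G4 : Type := ZMod 4 × ZMod 4 × ZMod 4

def par (m : ZMod 4) : Bool := decide (m = 1 ∨ m = 3)
def hb (m : ZMod 4) : Bool := decide (m = 2 ∨ m = 3)
def db (b : Bool) : ZMod 4 := cond b 2 0
def lf (b : Bool) : ZMod 4 := cond b 1 0

def red (x : G4) : V3 := (par x.1, par x.2.1, par x.2.2)
def dbl (v : V3) : G4 := (db v.1, db v.2.1, db v.2.2)
def lft (v : V3) : G4 := (lf v.1, lf v.2.1, lf v.2.2)
def hlf (x : G4) : V3 := (hb x.1, hb x.2.1, hb x.2.2)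

def corr (m n : ZMod 4) : Bool := xor (par m && hb n) (par n && hb m)

def pp (s : Bool) (β : Bet) (x y : G4) : V3 :=
  bil β (red x) (red y) + sm (s && corr x.1 y.1) E2

def kap (s : Bool) (x y z : G4) : V3 := sm (s && (par x.1 && (par y.1 && par z.1))) E2

theorem V3.ext' {x y : V3} (h1 : x.1 = y.1) (h2 : x.2.1 = y.2.1) (h3 : x.2.2 = y.2.2) : x = y :=
  Prod.ext h1 (Prod.ext h2 h3)

theorem par_add (m n : ZMod 4) : par (m + n) = xor (par m) (par n) := by revert m n; decide
theorem db_xor (a b : Bool) : db (xor a b) = db a + db b := by revert a b; decide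
theorem par_db (b : Bool) : par (db b) = false := by revert b; decide
theorem par_lf (b : Bool) : par (lf b) = b := by revert b; decide
theorem db_add_self (m : ZMod 4) : m + m = db (par m) := by revert m; decide
theorem db_inj {a b : Bool} (h : db a = db b) : a = b := by revert a b; decide
theorem db_hb {m : ZMod 4} (h : m + m = 0) : db (hb m) = m := by revert m; decide
theorem hb_db (b : Bool) : hb (db b) = b := by revert b; decide
theorem par_mul (m n : ZMod 4) : par (m * n) = (par m && par n) := by revert m n; decide
theorem db_mul (b : Bool) (n : ZMod 4) : db b * n = db (b && par n) := by revert b n; decide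

theorem red_add (x y : G4) : red (x + y) = red x + red y :=
  V3.ext' (par_add _ _) (par_add _ _) (par_add _ _)
theorem red_dbl (v : V3) : red (dbl v) = 0 := V3.ext' (par_db _) (par_db _) (par_db _)
theorem red_lft (v : V3) : red (lft v) = v := V3.ext' (par_lf _) (par_lf _) (par_lf _)
theorem red_zero : red 0 = 0 := by decide
theorem dbl_zero : dbl 0 = 0 := by decide
theorem dbl_add (u v : V3) : dbl (u + v) = dbl u + dbl v :=
  Prod.ext (db_xor _ _) (Prod.ext (db_xor _ _) (db_xor _ _))
theorem dbl_inj {u v : V3} (h : dbl u = dbl v) : u = v :=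
  V3.ext' (db_inj (congrArg (fun x : G4 => x.1) h)) (db_inj (congrArg (fun x : G4 => x.2.1) h))
    (db_inj (congrArg (fun x : G4 => x.2.2) h))
theorem add_self_G (x : G4) : x + x = dbl (red x) :=
  Prod.ext (db_add_self _) (Prod.ext (db_add_self _) (db_add_self _))
theorem dbl_hlf {x : G4} (h : x + x = 0) : dbl (hlf x) = x :=
  Prod.ext (db_hb (congrArg (fun x : G4 => x.1) h))
    (Prod.ext (db_hb (congrArg (fun x : G4 => x.2.1) h)) (db_hb (congrArg (fun x : G4 => x.2.2) h)))
theorem dbl_add_self (v : V3) : dbl v + dbl v = 0 := by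
  rw [← dbl_add, V3.add_self, dbl_zero]
theorem red_smul (m : ZMod 4) (x : G4) : red (m • x) = sm (par m) (red x) := by
  obtain ⟨a, b, c⟩ := x
  have : red (m • (a, b, c)) = (par (m * a), par (m * b), par (m * c)) := rfl
  rw [this, par_mul, par_mul, par_mul]
  cases par m <;> rfl
theorem db_smul (b : Bool) (x : G4) : db b • x = dbl (sm b (red x)) := by
  obtain ⟨u, v, w⟩ := x
  have : db b • ((u, v, w) : G4) = (db b * u, db b * v, db b * w) := rfl
  rw [this, db_mul, db_mul, db_mul]
  cases b <;> rfl
theorem exists_dbl {x : G4} (h : red x = 0) : ∃ v, x = dbl v :=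
  ⟨hlf x, (dbl_hlf (by rw [add_self_G, h, dbl_zero])).symm⟩

theorem sm_xor (a b : Bool) (v : V3) : sm (xor a b) v = sm a v + sm b v := by
  revert a b v; decide
theorem sm_add (a : Bool) (u v : V3) : sm a (u + v) = sm a u + sm a v := by
  revert a u v; decide
theorem sm_sm (a b : Bool) (v : V3) : sm a (sm b v) = sm (a && b) v := by
  revert a b v; decide
theorem sm_false (v : V3) : sm false v = 0 := rfl
theorem sm_true (v : V3) : sm true v = v := rfl
theorem add1 (u v : V3) : (u + v).1 = xor u.1 v.1 := rfl
theorem add2 (u v : V3) : (u + v).2.1 = xor u.2.1 v.2.1 := rfl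
theorem add3 (u v : V3) : (u + v).2.2 = xor u.2.2 v.2.2 := rfl
theorem sm1 (a : Bool) (u : V3) : (sm a u).1 = (a && u.1) := by revert a u; decide
theorem sm2 (a : Bool) (u : V3) : (sm a u).2.1 = (a && u.2.1) := by revert a u; decide
theorem sm3 (a : Bool) (u : V3) : (sm a u).2.2 = (a && u.2.2) := by revert a u; decide

theorem ap_add (m : M3) (u v : V3) : ap m (u + v) = ap m u + ap m v := by
  simp only [ap, add1, add2, add3, sm_xor]; abel
theorem ap_sm (m : M3) (a : Bool) (v : V3) : ap m (sm a v) = sm a (ap m v) := by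
  cases a
  · simp [sm_false, ap]; rfl
  · rfl
theorem ap_zero (m : M3) : ap m 0 = 0 := ap_sm m false 0
theorem ap_E1 (m : M3) : ap m E1 = m.1 := by simp [ap, E1, sm]
theorem ap_E2 (m : M3) : ap m E2 = m.2.1 := by simp [ap, E2, sm]
theorem ap_E3 (m : M3) : ap m E3 = m.2.2 := by simp [ap, E3, sm]
theorem ap_one (v : V3) : ap one3 v = v := by revert v; decide
theorem ap_mm (g h : M3) (v : V3) : ap (mm g h) v = ap g (ap h v) := by
  rw [ap.eq_1 h, ap_add, ap_add, ap_sm, ap_sm, ap_sm]; rfl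

theorem bil_add_left (β : Bet) (x y z : V3) : bil β (x + y) z = bil β x z + bil β y z := by
  simp only [bil, add1, add2, add3, sm_xor, Bool.and_xor_distrib_right]; abel
theorem bil_comm (β : Bet) (x y : V3) : bil β x y = bil β y x := by
  simp only [bil, sm_xor]
  rw [Bool.and_comm x.1 y.1, Bool.and_comm x.2.1 y.2.1, Bool.and_comm x.2.2 y.2.2,
    Bool.and_comm x.1 y.2.1, Bool.and_comm x.1 y.2.2, Bool.and_comm x.2.1 y.2.2,
    Bool.and_comm x.2.1 y.1, Bool.and_comm x.2.2 y.1, Bool.and_comm x.2.2 y.2.1]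
  abel
theorem bil_add_right (β : Bet) (x y z : V3) : bil β z (x + y) = bil β z x + bil β z y := by
  rw [bil_comm, bil_add_left, bil_comm β x, bil_comm β y]
theorem bil_zero_left (β : Bet) (x : V3) : bil β 0 x = 0 := by
  have := bil_add_left β 0 0 x
  rw [V3.add_self, V3.add_self] at this; exact this
theorem bil_zero_right (β : Bet) (x : V3) : bil β x 0 = 0 := by
  rw [bil_comm, bil_zero_left]
theorem bil_sm_left (β : Bet) (a : Bool) (x y : V3) : bil β (sm a x) y = sm a (bil β x y) := by
  cases a
  · exact bil_zero_left β y
  · rfl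
theorem bil_sm_right (β : Bet) (a : Bool) (x y : V3) : bil β x (sm a y) = sm a (bil β x y) := by
  rw [bil_comm, bil_sm_left, bil_comm]
theorem bil_self (β : Bet) (x : V3) : bil β x x = ap β.1 x := by
  simp [bil, ap, Bool.and_comm, sm_false]

theorem corr_comm (m n : ZMod 4) : corr m n = corr n m := by revert m n; decide
theorem corr_add (m n k : ZMod 4) :
    corr (m + n) k = xor (xor (corr m k) (corr n k)) (par m && (par n && par k)) := by
  revert m n k; decide
theorem corr_db (b : Bool) (k : ZMod 4) : corr (db b) k = (b && par k) := by
  revert b k; decide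
theorem corr_self (m : ZMod 4) : corr m m = false := by revert m; decide

theorem pp_comm (s : Bool) (β : Bet) (x y : G4) : pp s β x y = pp s β y x := by
  simp only [pp]; rw [bil_comm, corr_comm]

theorem pp_add (s : Bool) (β : Bet) (x y z : G4) :
    pp s β (x + y) z = pp s β x z + pp s β y z + kap s x y z := by
  simp only [pp, kap, red_add, bil_add_left, Prod.fst_add, corr_add, Bool.and_xor_distrib_left,
    sm_xor]
  abel

def Wf (s : Bool) (β : Bet) : Prop := s = true → ∀ x y : V3, (bil β x y).1 = (x.1 && y.1)

theorem pp_fst {s : Bool} {β : Bet} (h : Wf s β) (hs : s = true) (x y : G4) :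
    (pp s β x y).1 = (par x.1 && par y.1) := by
  simp only [pp, add1, sm1, h hs]
  simp [red, E2]

theorem pp_dbl {s : Bool} {β : Bet} (h : Wf s β) (x y z : G4) :
    pp s β (dbl (pp s β x y)) z = kap s x y z := by
  cases hs : s with
  | false => simp [pp, kap, red_dbl, bil_zero_left]
  | true =>
    subst hs
    have := pp_fst h rfl x y
    have e : pp true β (dbl (pp true β x y)) z
        = sm (corr (db (pp true β x y).1) z.1) E2 := by
      rw [pp, red_dbl, bil_zero_left, zero_add]; rfl
    rw [e, corr_db, this]; simp [kap, Bool.and_assoc]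

theorem kap_dbl (s : Bool) (v : V3) (y z : G4) : kap s y (dbl v) z = 0 := by
  simp only [kap, dbl, par_db]; simp [sm_false]

theorem kap_add (s : Bool) (x x' y z : G4) : kap s (x + x') y z = kap s x y z + kap s x' y z := by
  simp only [kap, Prod.fst_add, par_add, ← sm_xor, Bool.and_xor_distrib_left,
    Bool.and_xor_distrib_right]
theorem kap_comm (s : Bool) (x y z : G4) : kap s x y z = kap s y x z := by
  simp only [kap]; rw [Bool.and_left_comm (par x.1)]
theorem kap_comm' (s : Bool) (x y z : G4) : kap s x y z = kap s x z y := by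
  simp only [kap]; rw [Bool.and_comm (par y.1)]

def oplus (s : Bool) (β : Bet) (x y : G4) : G4 := x + y + dbl (pp s β x y)

theorem v_eq_iff {u v : V3} : u = v ↔ u + v = 0 := by revert u v; decide

theorem pp_oplus {s : Bool} {β : Bet} (h : Wf s β) (x y z : G4) :
    pp s β (oplus s β x y) z = pp s β x z + pp s β y z := by
  rw [oplus, pp_add, pp_add, pp_dbl h, kap_dbl, add_zero, add_assoc, V3.add_self, add_zero]

theorem oplus_comm (s : Bool) (β : Bet) (x y : G4) : oplus s β x y = oplus s β y x := by
  rw [oplus, oplus, pp_comm, add_comm x y]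

theorem oplus_assoc {s : Bool} {β : Bet} (h : Wf s β) (x y z : G4) :
    oplus s β (oplus s β x y) z = oplus s β x (oplus s β y z) := by
  rw [oplus, pp_oplus h, oplus.eq_1 s β x (oplus s β y z), pp_comm s β x (oplus s β y z),
    pp_oplus h, oplus, oplus]
  simp only [dbl_add]
  rw [pp_comm s β z x, pp_comm s β y x]
  abel

theorem pp_zero (s : Bool) (β : Bet) (x : G4) : pp s β 0 x = 0 := by
  have : corr 0 x.1 = false := by revert x; intro x; generalize x.1 = m; revert m; decide
  simp [pp, red_zero, bil_zero_left, this, sm_false]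

theorem oplus_zero (s : Bool) (β : Bet) (x : G4) : oplus s β 0 x = x := by
  rw [oplus, pp_zero, dbl_zero]; simp

theorem oplus_self (s : Bool) (β : Bet) (x : G4) :
    oplus s β x x = dbl (red x + ap β.1 (red x)) := by
  rw [oplus, add_self_G, dbl_add, pp, bil_self, corr_self]; simp [sm_false]

theorem oplus_dbl_dbl {s : Bool} {β : Bet} (u v : V3) :
    oplus s β (dbl u) (dbl v) = dbl (u + v) := by
  have : corr (dbl u).1 (dbl v).1 = false := by
    simp only [dbl, corr_db, par_db, Bool.and_false]
  rw [oplus, pp, red_dbl, bil_zero_left, this, dbl_add]; simp [sm_false, dbl_zero, dbl_add]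

def opneg (s : Bool) (β : Bet) (x : G4) : G4 := oplus s β (oplus s β x x) x

theorem opneg_cancel {s : Bool} {β : Bet} (h : Wf s β) (x : G4) :
    oplus s β (opneg s β x) x = 0 := by
  rw [opneg, oplus_assoc h, oplus_self s β x, oplus_dbl_dbl, V3.add_self, dbl_zero]

theorem brace_aux {s : Bool} {β : Bet} (h : Wf s β) (x y z : G4) :
    oplus s β (x + oplus s β y z) x = oplus s β (x + y) (x + z) := by
  have e : pp s β (x + oplus s β y z) x
      = pp s β x x + (pp s β y x + pp s β z x) + (kap s x y x + kap s x z x) := by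
    rw [pp_add, pp_oplus h, oplus, kap_comm s x, kap_add, kap_add, kap_comm s (dbl _), kap_dbl,
      kap_comm s y, kap_comm s z, add_zero]
  have e2 : pp s β (x + y) (x + z)
      = pp s β x x + (pp s β y x + pp s β z x) + (kap s x y x + kap s x z x) + pp s β y z := by
    rw [pp_add, pp_comm s β x, pp_comm s β y, pp_add, pp_add, kap_comm' s x y, kap_comm s x (x+z),
      kap_add, kap_comm' s x z y, kap_comm s z x y, kap_comm' s x z y, kap_comm' s x x y,
      pp_comm s β x y, pp_comm s β z y]
    rw [v_eq_iff]
    generalize pp s β x x = a1; generalize pp s β z x = a2; generalize pp s β y x = a3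
    generalize pp s β y z = a4; generalize kap s x z x = a5; generalize kap s x y x = a6
    generalize kap s x y z = a7
    have : ∀ a1 a2 a3 a4 a5 a6 a7 : V3, a1 + a2 + a5 + (a3 + a4 + a7) + (a6 + a7) +
        (a1 + (a3 + a2) + (a6 + a5) + a4) =
        (a1 + a1) + (a2 + a2) + (a3 + a3) + (a4 + a4) + (a5 + a5) + (a6 + a6) + (a7 + a7) := by
      intros; abel
    rw [this]; simp only [V3.add_self, add_zero]
  rw [oplus, e, oplus.eq_1 s β (x + y), e2, oplus]
  simp only [dbl_add]; abel

def MB (s : Bool) (β : Bet) (h : Wf s β) : LeftBrace G4 where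
  add := oplus s β
  zero := 0
  neg := opneg s β
  mul x y := x + y
  one := 0
  inv x := -x
  add_assoc := oplus_assoc h
  add_comm := oplus_comm s β
  zero_add := oplus_zero s β
  neg_add_cancel := opneg_cancel h
  mul_assoc := add_assoc
  one_mul := zero_add
  mul_one := add_zero
  inv_mul_cancel := neg_add_cancel
  brace := by
    intro x y z
    have h1 := brace_aux h x y z
    have key : oplus s β (oplus s β (x + oplus s β y z) x) (opneg s β x) = x + oplus s β y z := by
      rw [oplus_assoc h, oplus_comm s β x, opneg_cancel h, oplus_comm, oplus_zero]
    rw [← key, h1, oplus_assoc h, oplus_assoc h, oplus_comm s β (x + z)]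


/-! ### Isomorphisms between models -/

def B1 : G4 := (1, 0, 0)
def B2 : G4 := (0, 1, 0)
def B3 : G4 := (0, 0, 1)

def lin (c1 c2 c3 : G4) (x : G4) : G4 := x.1 • c1 + x.2.1 • c2 + x.2.2 • c3

theorem lin_add (c1 c2 c3 x y : G4) : lin c1 c2 c3 (x + y) = lin c1 c2 c3 x + lin c1 c2 c3 y := by
  simp only [lin, Prod.fst_add, Prod.snd_add, add_smul]; abel

theorem red_lin (c1 c2 c3 x : G4) :
    red (lin c1 c2 c3 x) = ap (red c1, red c2, red c3) (red x) := by
  simp only [lin, red_add, red_smul, ap]; rfl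

theorem lin_dbl (c1 c2 c3 : G4) (v : V3) :
    lin c1 c2 c3 (dbl v) = dbl (ap (red c1, red c2, red c3) v) := by
  simp only [lin, ap, dbl_add, ← db_smul]; rfl

theorem eq_lin (f : G4 →+ G4) (x : G4) : f x = lin (f B1) (f B2) (f B3) x := by
  have : x = x.1 • B1 + x.2.1 • B2 + x.2.2 • B3 := by
    obtain ⟨a, b, c⟩ := x
    simp [B1, B2, B3]
  conv_lhs => rw [this]
  rw [map_add, map_add, ZMod.map_smul, ZMod.map_smul, ZMod.map_smul]; rfl

theorem ap_ap_of {g h : M3} (e : mm g h = one3) (v : V3) : ap g (ap h v) = v := by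
  rw [← ap_mm, e, ap_one]

theorem lin_bij {c1 c2 c3 : G4} {g : M3} (e : mm g (red c1, red c2, red c3) = one3) :
    Function.Bijective (lin c1 c2 c3) := by
  rw [← Finite.injective_iff_bijective]
  have key : ∀ x, lin c1 c2 c3 x = 0 → x = 0 := by
    intro x hx
    have h1 : ap (red c1, red c2, red c3) (red x) = 0 := by rw [← red_lin, hx, red_zero]
    have h2 : red x = 0 := by rw [← ap_ap_of e (red x), h1, ap_zero]
    obtain ⟨v, rfl⟩ := exists_dbl h2
    rw [lin_dbl, ← dbl_zero] at hx
    have h3 := dbl_inj hx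
    rw [← ap_ap_of e v, h3, ap_zero, dbl_zero]
  intro x y hxy
  have := key (x - y) (by
    have e1 := lin_add c1 c2 c3 (x - y) y
    rw [sub_add_cancel, hxy] at e1
    exact left_eq_add.mp (by rw [add_comm]; exact e1) )
  exact sub_eq_zero.mp this

theorem corr_shift (m m' : ZMod 4) (u u' : Bool) :
    corr (m + db u) (m' + db u') = xor (corr m m') (xor (par m && u') (par m' && u)) := by
  revert m m' u u'; decide

def act (g h : M3) (β : Bet) : Bet := (actS g h β.1, actO g h β)

def shft (a b : Bool) (β : Bet) : Bet := (β.1, (β.2.1 + sm a E2, β.2.2.1 + sm b E2, β.2.2.2))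

theorem bil_expand (β : Bet) (c1 c2 c3 : V3) (x y : V3) :
    bil β (ap (c1, c2, c3) x) (ap (c1, c2, c3) y) =
    bil ((bil β c1 c1, bil β c2 c2, bil β c3 c3), (bil β c1 c2, bil β c1 c3, bil β c2 c3)) x y := by
  simp only [ap, bil_add_left, bil_add_right, bil_sm_left, bil_sm_right, sm_sm, sm_add]
  rw [bil_comm β c2 c1, bil_comm β c3 c1, bil_comm β c3 c2]
  generalize bil β c1 c1 = b1
  generalize bil β c2 c2 = b2
  generalize bil β c3 c3 = b3
  generalize bil β c1 c2 = b4
  generalize bil β c1 c3 = b5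
  generalize bil β c2 c3 = b6
  simp only [bil, sm_xor]
  simp only [Bool.and_comm]
  abel

theorem bil_map (g : M3) (β : Bet) (x y : V3) :
    ap g (bil β x y) = bil (mm g β.1, mm g β.2) x y := by
  simp only [bil, ap_add, ap_sm]; rfl

theorem mm_mm {g h : M3} (e : mm g h = one3) (m : M3) : mm g (mm h m) = m := by
  simp only [mm, ap_ap_of e]

theorem bil_act {g h : M3} (hg : mm h g = one3) (β : Bet) (x y : V3) :
    ap h (bil (act g h β) x y) = bil β (ap h x) (ap h y) := by
  rw [bil_map, bil_expand β h.1 h.2.1 h.2.2 x y, act]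
  simp only [actS, mm_mm hg]
  simp only [actO, bil_self]
  simp only [mm, ap_ap_of hg]

theorem bil_shft (a b : Bool) (β : Bet) (x y : V3) :
    bil (shft a b β) x y = bil β x y +
      (sm (a && xor (x.1 && y.2.1) (x.2.1 && y.1)) E2 +
       sm (b && xor (x.1 && y.2.2) (x.2.2 && y.1)) E2) := by
  simp only [bil, shft, sm_add, sm_sm]
  rw [Bool.and_comm a, Bool.and_comm b]
  abel

theorem iso_act {s : Bool} {β β' : Bet} (w : Wf s β) (w' : Wf s β') {g h : M3}
    (gh : mm g h = one3) (hg : mm h g = one3) (a b : Bool)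
    (hs : s = true → h.2.1 = E2 ∧ h.1.1 = true ∧ h.2.2.1 = false)
    (hβ : β' = shft (s && a) (s && b) (act g h β)) : (MB s β' w').Iso (MB s β w) := by
  set c1 := lft h.1
  set c2 := lft h.2.1 + dbl (sm a E1)
  set c3 := lft h.2.2 + dbl (sm b E1)
  have hc : (red c1, red c2, red c3) = h := by
    simp only [c1, c2, c3, red_add, red_lft, red_dbl, add_zero]
  have key : ∀ x y, ap h (pp s β' x y) = pp s β (lin c1 c2 c3 x) (lin c1 c2 c3 y) := by
    intro x y
    simp only [pp, red_lin, hc]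
    rw [hβ, bil_shft, ap_add, ap_add, bil_act hg]
    cases s with
    | false => simp [sm_false, ap_zero]
    | true =>
      obtain ⟨h2, h1, h3⟩ := hs rfl
      have hl : ∀ x, (lin c1 c2 c3 x).1 =
          x.1 + db (xor (a && (red x).2.1) (b && (red x).2.2)) := by
        intro x
        have : (lin c1 c2 c3 x).1 = x.1 * lf h.1.1 + x.2.1 * (lf h.2.1.1 + db (sm a E1).1) +
          x.2.2 * (lf h.2.2.1 + db (sm b E1).1) := rfl
        rw [this, h1, h2, h3, db_xor, sm1, sm1]
        have q1 : (red x).2.1 = par x.2.1 := rfl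
        have q2 : (red x).2.2 = par x.2.2 := rfl
        rw [q1, q2, ← db_mul, ← db_mul]
        simp [E1, E2, lf, mul_comm, add_assoc]
      rw [hl, hl, corr_shift]
      simp only [Bool.true_and, sm_xor, ap_add, ap_sm, ap_E2, h2, Bool.and_xor_distrib_left]
      have q1 : (red x).1 = par x.1 := rfl
      have q2 : (red y).1 = par y.1 := rfl
      rw [q1, q2]
      generalize par x.1 = u1; generalize par y.1 = v1
      generalize (red x).2.1 = u2; generalize (red y).2.1 = v2
      generalize (red x).2.2 = u3; generalize (red y).2.2 = v3
      have r1 : (u1 && (a && v2)) = (a && (u1 && v2)) := by rw [Bool.and_left_comm]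
      have r2 : (u1 && (b && v3)) = (b && (u1 && v3)) := by rw [Bool.and_left_comm]
      have r3 : (v1 && (a && u2)) = (a && (u2 && v1)) := by
        rw [Bool.and_left_comm, Bool.and_comm v1]
      have r4 : (v1 && (b && u3)) = (b && (u3 && v1)) := by
        rw [Bool.and_left_comm, Bool.and_comm v1]
      rw [r1, r2, r3, r4]
      abel
  refine ⟨Equiv.ofBijective _ (lin_bij (g := g) (by rw [hc]; exact gh)), ?_, ?_⟩
  · intro x y
    change lin c1 c2 c3 (oplus s β' x y) = oplus s β (lin c1 c2 c3 x) (lin c1 c2 c3 y)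
    rw [oplus, lin_add, lin_add, lin_dbl, hc, key]; rfl
  · intro x y
    exact lin_add c1 c2 c3 x y

structure IsoData (s s' : Bool) (β β' : Bet) (f : G4 ≃+ G4) (g h : M3) : Prop where
  gh : mm g h = one3
  hg : mm h g = one3
  rg : ∀ x, red (f x) = ap g (red x)
  rh : ∀ x, red (f.symm x) = ap h (red x)
  hp : ∀ x y, pp s' β' (f x) (f y) = ap g (pp s β x y)
  hk : ∀ x y z, kap s' (f x) (f y) (f z) = ap g (kap s x y z)
  hcol : h = (red (f.symm B1), red (f.symm B2), red (f.symm B3))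

theorem exists_isoData {s s' : Bool} {β β' : Bet} (w : Wf s β) (w' : Wf s' β')
    (hI : (MB s β w).Iso (MB s' β' w')) : ∃ f g h, IsoData s s' β β' f g h := by
  obtain ⟨e, ha, hm⟩ := hI
  let f : G4 ≃+ G4 := { e with map_add' := hm }
  have ha' : ∀ x y, f (oplus s β x y) = oplus s' β' (f x) (f y) := ha
  have main : ∀ f : G4 ≃+ G4, ∀ x, red (f x) = ap (red (f B1), red (f B2), red (f B3)) (red x) := by
    intro f x
    have := eq_lin f.toAddMonoidHom x
    have e : f x = lin (f B1) (f B2) (f B3) x := this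
    rw [e, red_lin]
  set g : M3 := (red (f B1), red (f B2), red (f B3)) with hg
  set h : M3 := (red (f.symm B1), red (f.symm B2), red (f.symm B3)) with hh
  have fd : ∀ v, f (dbl v) = dbl (ap g v) := by
    intro v
    have e : f (dbl v) = lin (f B1) (f B2) (f B3) (dbl v) := eq_lin f.toAddMonoidHom _
    rw [e, lin_dbl]
  have hp : ∀ x y, pp s' β' (f x) (f y) = ap g (pp s β x y) := by
    intro x y
    have := ha' x y
    rw [oplus, oplus, map_add, map_add, fd] at this
    exact (dbl_inj (add_left_cancel this)).symm
  have r1 : red B1 = E1 := by decide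
  have r2 : red B2 = E2 := by decide
  have r3 : red B3 = E3 := by decide
  refine ⟨f, g, h, ?_, ?_, main f, main f.symm, hp, ?_, rfl⟩
  · rw [mm, hh]
    simp only [hg, ← main f, AddEquiv.apply_symm_apply, r1, r2, r3]; rfl
  · rw [mm, hg]
    simp only [hh, ← main f.symm, AddEquiv.symm_apply_apply, r1, r2, r3]; rfl
  · intro x y z
    rw [← pp_dbl w' (f x) (f y) (f z), hp, ← fd, hp, pp_dbl w]

theorem iso_s {s s' : Bool} {β β' : Bet} {f : G4 ≃+ G4} {g h : M3}
    (D : IsoData s s' β β' f g h) (hs : s = true) : s' = true := by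
  have k := D.hk B1 B1 B1
  subst hs
  by_contra hc
  have hc : s' = false := by simpa using hc
  subst hc
  have e1 : kap true B1 B1 B1 = E2 := by decide
  have e2 : ap g E2 = 0 := by rw [← e1, ← k]; rfl
  have := ap_ap_of D.hg E2
  rw [e2, ap_zero] at this
  revert this; decide

theorem iso_true {β β' : Bet} {f : G4 ≃+ G4} {g h : M3}
    (D : IsoData true true β β' f g h) : g.2.1 = E2 ∧ ∀ x, par (f x).1 = par x.1 := by
  have k := D.hk B1 B1 B1
  have e1 : kap true B1 B1 B1 = E2 := by decide
  rw [e1, ap_E2] at k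
  have hne : g.2.1 ≠ 0 := by
    intro hc
    have := ap_ap_of D.hg E2
    rw [ap_E2, hc, ap_zero] at this
    revert this; decide
  have h1 : par (f B1).1 = true := by
    by_contra hc
    have hc : par (f B1).1 = false := by simpa using hc
    apply hne; rw [← k, kap, hc]; rfl
  have h2 : g.2.1 = E2 := by rw [← k, kap, h1]; rfl
  refine ⟨h2, fun x => ?_⟩
  have k2 := D.hk B1 B1 x
  have e3 : par B1.1 = true := by decide
  rw [kap, kap, h1, e3, ap_sm, ap_E2, h2] at k2
  revert k2
  generalize par (f x).1 = u; generalize par x.1 = v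
  revert u v; decide

theorem act_of_iso {s : Bool} {β β' : Bet} (w : Wf s β) (w' : Wf s β')
    (hI : (MB s β w).Iso (MB s β' w')) :
    ∃ g h a b, mm g h = one3 ∧ mm h g = one3 ∧
      (s = true → g.2.1 = E2 ∧ g.1.1 = true ∧ g.2.2.1 = false) ∧
      β' = shft (s && a) (s && b) (act g h β) := by
  obtain ⟨f, g, h, D⟩ := exists_isoData w w' hI
  have hb : ∀ x y, pp s β' x y = ap g (pp s β (f.symm x) (f.symm y)) := by
    intro x y
    rw [← D.hp, AddEquiv.apply_symm_apply, AddEquiv.apply_symm_apply]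
  have g1 : red (f B1) = g.1 := by rw [D.rg, ← ap_E1 g]; rfl
  have g3 : red (f B3) = g.2.2 := by rw [D.rg, ← ap_E3 g]; rfl
  have hc1 : h.1 = red (f.symm B1) := by rw [D.hcol]
  have hc2 : h.2.1 = red (f.symm B2) := by rw [D.hcol]
  have hc3 : h.2.2 = red (f.symm B3) := by rw [D.hcol]
  have gE : s = true → g.2.1 = E2 := by
    intro hs; subst hs; exact (iso_true D).1
  refine ⟨g, h, corr (f.symm B1).1 (f.symm B2).1, corr (f.symm B1).1 (f.symm B3).1, D.gh, D.hg,
    ?_, ?_⟩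
  · intro hs
    subst hs
    obtain ⟨t1, t2⟩ := iso_true D
    refine ⟨t1, ?_, ?_⟩
    · rw [← g1]; exact (t2 B1).trans (by decide)
    · rw [← g3]; exact (t2 B3).trans (by decide)
  · have gsm : ∀ c, ap g (sm (s && c) E2) = sm (s && c) E2 := by
      intro c
      cases hs : s with
      | false => exact ap_zero g
      | true => rw [ap_sm, ap_E2, gE hs]
    have c23 : (s && corr (f.symm B2).1 (f.symm B3).1) = false := by
      cases hs : s with
      | false => rfl
      | true =>
        subst hs
        obtain ⟨t1, t2⟩ := iso_true D
        have u2 := t2 (f.symm B2)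
        have u3 := t2 (f.symm B3)
        rw [AddEquiv.apply_symm_apply] at u2 u3
        have v2 : par (f.symm B2).1 = false := u2.symm.trans (by decide)
        have v3 : par (f.symm B3).1 = false := u3.symm.trans (by decide)
        rw [corr, v2, v3]; rfl
    have pB : pp s β' B1 B1 = β'.1.1 ∧ pp s β' B2 B2 = β'.1.2.1 ∧ pp s β' B3 B3 = β'.1.2.2 ∧
        pp s β' B1 B2 = β'.2.1 ∧ pp s β' B1 B3 = β'.2.2.1 ∧ pp s β' B2 B3 = β'.2.2.2 := by
      have r1 : red B1 = E1 := by decide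
      have r2 : red B2 = E2 := by decide
      have r3 : red B3 = E3 := by decide
      have k1 : corr B1.1 B1.1 = false := by decide
      have k2 : corr B1.1 B2.1 = false := by decide
      have k3 : corr B2.1 B3.1 = false := by decide
      have k4 : corr B1.1 B3.1 = false := by decide
      have k5 : corr B2.1 B2.1 = false := by decide
      have k6 : corr B3.1 B3.1 = false := by decide
      simp only [pp, r1, r2, r3, k1, k2, k3, k4, k5, k6]
      simp only [Bool.and_false, sm_false, add_zero]
      simp [bil, E1, E2, E3, sm]
    obtain ⟨p1, p2, p3, p4, p5, p6⟩ := pB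
    have sq : ∀ x, pp s β (f.symm x) (f.symm x) = ap β.1 (red (f.symm x)) := by
      intro x; rw [pp, bil_self, corr_self]; simp [sm_false]
    rw [hb, sq] at p1 p2 p3
    rw [hb, pp, ap_add, gsm] at p4 p5 p6
    rw [c23, sm_false, add_zero] at p6
    rw [← hc1] at p1 p4 p5
    rw [← hc2] at p2 p4 p6
    rw [← hc3] at p3 p5 p6
    exact Prod.ext (Prod.ext p1.symm (Prod.ext p2.symm p3.symm))
      (Prod.ext p4.symm (Prod.ext p5.symm p6.symm))


/-! ### Canonical representatives -/

theorem LeftBrace.Iso.refl {B : Type*} (L : LeftBrace B) : L.Iso L :=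
  ⟨Equiv.refl B, fun _ _ => rfl, fun _ _ => rfl⟩

theorem LeftBrace.Iso.symm {B₁ B₂ : Type*} {L₁ : LeftBrace B₁} {L₂ : LeftBrace B₂}
    (h : L₁.Iso L₂) : L₂.Iso L₁ := by
  obtain ⟨e, ha, hm⟩ := h
  refine ⟨e.symm, fun x y => ?_, fun x y => ?_⟩
  · rw [Equiv.symm_apply_eq, ha, Equiv.apply_symm_apply, Equiv.apply_symm_apply]
  · rw [Equiv.symm_apply_eq, hm, Equiv.apply_symm_apply, Equiv.apply_symm_apply]

theorem LeftBrace.Iso.trans {B₁ B₂ B₃ : Type*} {L₁ : LeftBrace B₁} {L₂ : LeftBrace B₂}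
    {L₃ : LeftBrace B₃} (h : L₁.Iso L₂) (k : L₂.Iso L₃) : L₁.Iso L₃ := by
  obtain ⟨e, ha, hm⟩ := h
  obtain ⟨f, fa, fm⟩ := k
  refine ⟨e.trans f, fun x y => ?_, fun x y => ?_⟩
  · simp only [Equiv.trans_apply, ha, fa]
  · simp only [Equiv.trans_apply, hm, fm]

theorem eqV_iff {x y : V3} : eqV x y = true ↔ x = y := by revert x y; decide
theorem eqM_iff {x y : M3} : eqM x y = true ↔ x = y := by
  simp only [eqM, Bool.and_eq_true, eqV_iff, Prod.ext_iff (α := V3)]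

theorem mem_allV (v : V3) : v ∈ allV := by revert v; decide
theorem mem_allM (m : M3) : m ∈ allM := by
  obtain ⟨a, b, c⟩ := m
  exact List.mem_flatMap.2 ⟨a, mem_allV a, List.mem_flatMap.2 ⟨b, mem_allV b,
    List.mem_map.2 ⟨c, mem_allV c, rfl⟩⟩⟩

theorem nodup_allM : allM.Nodup := by
  have h : allV.Nodup := by decide
  have e : allM = allV ×ˢ (allV ×ˢ allV) := by
    change allM = List.product allV (List.product allV allV)
    simp only [allM, List.product, List.map_flatMap, List.map_map]; rfl
  rw [e]
  exact h.product (h.product h)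

theorem cv_inj {u v : V3} (h : cv u = cv v) : u = v := by
  revert u v; decide
theorem cv_lt (v : V3) : cv v < 8 := by revert v; decide

theorem cm_inj {m n : M3} (h : cm m = cm n) : m = n := by
  obtain ⟨a, b, c⟩ := m
  obtain ⟨a', b', c'⟩ := n
  simp only [cm] at h
  have h1 := cv_lt b
  have h2 := cv_lt b'
  have h3 := cv_lt c
  have h4 := cv_lt c'
  rw [cv_inj (show cv a = cv a' by omega), cv_inj (show cv b = cv b' by omega),
    cv_inj (show cv c = cv c' by omega)]

theorem cm_lt (m : M3) : cm m < 512 := by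
  have h1 := cv_lt m.1
  have h2 := cv_lt m.2.1
  have h3 := cv_lt m.2.2
  simp only [cm]; omega

theorem adj_or_aux : (allM.all fun g => foM g fun g => foM (adj g) fun h => foM (mm g h) fun u =>
    eqM u one3 || allV.any fun v => fo v fun v => fo (ap g v) fun w =>
      eqV w (false, false, false) && !eqV v (false, false, false)) = true := by decide +kernel

theorem adj_or (g : M3) : mm g (adj g) = one3 ∨ ∃ v, ap g v = 0 ∧ v ≠ 0 := by
  have h := List.all_eq_true.1 adj_or_aux g (mem_allM g)
  simp only [foM_eq, fo_eq, Bool.or_eq_true, eqM_iff, List.any_eq_true, Bool.and_eq_true,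
    Bool.not_eq_true', ← Bool.not_eq_true] at h
  rcases h with h | ⟨v, -, h1, h2⟩
  · exact Or.inl h
  · exact Or.inr ⟨v, eqV_iff.1 h1, fun hv => h2 (eqV_iff.2 hv)⟩

theorem mm_comm_one {g h : M3} (gh : mm g h = one3) : mm h g = one3 := by
  have hs : Function.Surjective (ap g) := fun v => ⟨ap h v, ap_ap_of gh v⟩
  have hi := Finite.injective_iff_surjective.2 hs
  have k : ∀ v, ap h (ap g v) = v := fun v => hi (ap_ap_of gh _)
  have k1 := k E1
  have k2 := k E2
  have k3 := k E3
  rw [ap_E1] at k1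
  rw [ap_E2] at k2
  rw [ap_E3] at k3
  rw [mm, k1, k2, k3]; rfl

theorem mem_glL {g h : M3} (hg : mm h g = one3) : (g, h) ∈ glL := by
  have h1 : mm g (adj g) = one3 := by
    rcases adj_or g with h1 | ⟨v, h1, h2⟩
    · exact h1
    · exfalso; apply h2; rw [← ap_ap_of hg v, h1, ap_zero]
  have h2 : h = adj g := by
    have := mm_mm hg (adj g)
    rw [h1] at this
    rw [← this]
    obtain ⟨a, b, c⟩ := h
    simp only [mm, one3, ap_E1, ap_E2, ap_E3]
  subst h2
  exact List.mem_map.2 ⟨g, List.mem_filter.2 ⟨mem_allM g, by simp only [foM_eq]; exact eqM_iff.2 h1⟩, rfl⟩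

theorem of_glL {p : M3 × M3} (hp : p ∈ glL) : mm p.1 p.2 = one3 ∧ mm p.2 p.1 = one3 := by
  obtain ⟨g, hg, rfl⟩ := List.mem_map.1 hp
  have h1 := (List.mem_filter.1 hg).2
  simp only [foM_eq, eqM_iff] at h1
  exact ⟨h1, mm_comm_one h1⟩

theorem gl8_inv {g h : M3} (gh : mm g h = one3) (hg : mm h g = one3)
    (c : g.2.1 = E2 ∧ g.1.1 = true ∧ g.2.2.1 = false) :
    h.2.1 = E2 ∧ h.1.1 = true ∧ h.2.2.1 = false := by
  obtain ⟨c1, c2, c3⟩ := c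
  have k : ∀ v, (ap g v).1 = v.1 := by
    intro v
    simp only [ap, add1, sm1, c1, c2, c3]; simp [E2]
  refine ⟨?_, ?_, ?_⟩
  · have := congrArg (fun m : M3 => m.2.1) hg
    simp only [mm, c1, ap_E2] at this
    exact this
  · rw [← k]; exact congrArg (fun m : M3 => m.1.1) gh
  · rw [← k]; exact congrArg (fun m : M3 => m.2.2.1) gh

theorem mem_gl8 {g h : M3} (hg : mm h g = one3)
    (h2 : g.2.1 = E2 ∧ g.1.1 = true ∧ g.2.2.1 = false) : (g, h) ∈ gl8 := by
  refine List.mem_filter.2 ⟨mem_glL hg, ?_⟩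
  simp [h2.1, h2.2.1, h2.2.2, eqV_iff]

theorem of_gl8 {p : M3 × M3} (hp : p ∈ gl8) :
    p.2.2.1 = E2 ∧ p.2.1.1 = true ∧ p.2.2.2.1 = false := by
  obtain ⟨h1, h2⟩ := List.mem_filter.1 hp
  obtain ⟨k1, k2⟩ := of_glL h1
  exact gl8_inv k1 k2 (by simpa [eqV_iff] using h2)

theorem mem_cen {p : M3 × M3} {s : M3} : p ∈ cen s ↔ p ∈ glL ∧ actS p.1 p.2 s = s := by
  simp only [cen, List.mem_filter, foM_eq, foS_eq, eqM_iff]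

theorem glL_of_gl8 {p : M3 × M3} (hp : p ∈ gl8) : p ∈ glL := (List.mem_filter.1 hp).1

attribute [local irreducible] allM glL gl8 cen

theorem wfF (β : Bet) : Wf false β := fun h => by cases h

def canon1 (β : Bet) : Bool := smin β.1 && omin (cen β.1) β.1 β.2
def canon2 (β : Bet) : Bool := (wfS β.1 && wfO β.2) && ok2 gl8 β

theorem shft_false (β : Bet) : shft false false β = β := by
  simp only [shft, sm_false, add_zero]

theorem act_one (β : Bet) : act one3 one3 β = β := by
  obtain ⟨⟨a, b, c⟩, d, e, f⟩ := β
  simp only [act, actS, actO, mm, ap_one]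
  simp only [one3, ap_E1, ap_E2, ap_E3]
  simp [bil, E1, E2, E3, sm]

theorem shft_nrm (β : Bet) : ∃ a b, (β.1, nrm β.2) = shft a b β := by
  refine ⟨β.2.1.2.1, β.2.2.1.2.1, ?_⟩
  obtain ⟨s, u, v, w⟩ := β
  refine Prod.ext rfl (Prod.ext ?_ (Prod.ext ?_ rfl))
  · exact eqV_iff.1 ((by decide : ∀ u : V3, eqV (u.1, false, u.2.2) (u + sm u.2.1 E2) = true) u)
  · exact eqV_iff.1 ((by decide : ∀ u : V3, eqV (u.1, false, u.2.2) (u + sm u.2.1 E2) = true) v)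

theorem nrm_shft (a b : Bool) (β : Bet) : nrm (shft a b β).2 = nrm β.2 := by
  obtain ⟨s, u, v, w⟩ := β
  have : ∀ a, ∀ u : V3, ((u + sm a E2).1, false, (u + sm a E2).2.2) = ((u.1, false, u.2.2) : V3) := by
    decide
  exact Prod.ext (this a u) (Prod.ext (this b v) rfl)

theorem wfO_nrm {o : M3} (h : wfO o = true) : nrm o = o := by
  obtain ⟨⟨u1, u2, u3⟩, ⟨v1, v2, v3⟩, w⟩ := o
  simp only [wfO, Bool.and_eq_true, Bool.not_eq_true'] at h
  simp only [nrm, h.2.1, h.2.2]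

theorem Wf_of {β : Bet} (hs : wfS β.1 = true) (ho : wfO β.2 = true) : Wf true β := by
  intro _ x y
  simp only [wfS, wfO, Bool.and_eq_true, Bool.not_eq_true'] at hs ho
  simp only [bil, add1, sm1, hs.1, hs.2.1, hs.2.2.1, ho.1.1, ho.1.2.1, ho.1.2.2]
  simp

theorem of_Wf {β : Bet} (h : Wf true β) (hr : rk β.1 = true) :
    wfS β.1 = true ∧ wfO (nrm β.2) = true := by
  have h := h rfl
  have h1 := h E1 E1
  have h2 := h E2 E2
  have h3 := h E3 E3
  have h4 := h E1 E2
  have h5 := h E1 E3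
  have h6 := h E2 E3
  simp only [bil, add1, sm1, E1, E2, E3] at h1 h2 h3 h4 h5 h6
  simp at h1 h2 h3 h4 h5 h6
  simp only [wfS, wfO, nrm, h1, h2, h3, h4, h5, h6, hr]
  decide

theorem ble_le {a b : ℕ} : Nat.ble a b = true ↔ a ≤ b := by rw [Nat.ble_eq]

theorem canon1_inj {β β' : Bet} (h : canon1 β = true) (h' : canon1 β' = true)
    (hI : (MB false β (wfF β)).Iso (MB false β' (wfF β'))) : β = β' := by
  have half : ∀ {β β' : Bet}, canon1 β = true →
      (MB false β (wfF β)).Iso (MB false β' (wfF β')) →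
      cm β.1 ≤ cm β'.1 ∧ (β.1 = β'.1 → cm β.2 ≤ cm β'.2) := by
    intro β β' h hI
    obtain ⟨g, h', a, b, -, hg, -, e⟩ := act_of_iso _ _ hI
    rw [Bool.false_and, Bool.false_and, shft_false] at e
    have hm := mem_glL hg
    simp only [canon1, smin, omin, foM_eq, foS_eq, foO_eq, Bool.and_eq_true, List.all_eq_true, ble_le] at h
    subst e
    refine ⟨h.1.2 (g, h') hm, fun hs => ?_⟩
    exact h.2 (g, h') (mem_cen.2 ⟨hm, hs.symm⟩)
  obtain ⟨a1, a2⟩ := half h hI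
  obtain ⟨b1, b2⟩ := half h' hI.symm
  have e1 := cm_inj (le_antisymm a1 b1)
  exact Prod.ext e1 (cm_inj (le_antisymm (a2 e1) (b2 e1.symm)))

theorem cb_inj {β β' : Bet} (h : cb β = cb β') : β = β' := by
  have h1 := cm_lt β.2
  have h2 := cm_lt β'.2
  simp only [cb] at h
  exact Prod.ext (cm_inj (by omega)) (cm_inj (by omega))

theorem canon2_Wf {β : Bet} (h : canon2 β = true) : Wf true β := by
  simp only [canon2, Bool.and_eq_true] at h
  exact Wf_of h.1.1 h.1.2

theorem canon2_inj {β β' : Bet} (h : canon2 β = true) (h' : canon2 β' = true)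
    (hI : (MB true β (canon2_Wf h)).Iso (MB true β' (canon2_Wf h'))) : β = β' := by
  have half : ∀ {β β' : Bet} (h : canon2 β = true) (h' : canon2 β' = true),
      (MB true β (canon2_Wf h)).Iso (MB true β' (canon2_Wf h')) → cb β ≤ cb β' := by
    intro β β' h h' hI
    obtain ⟨g, k, a, b, -, hg, hs, e⟩ := act_of_iso _ _ hI
    have hm := mem_gl8 hg (hs rfl)
    simp only [canon2, ok2, foM_eq, foS_eq, foO_eq, Bool.and_eq_true, List.all_eq_true] at h h'
    have e2 : β' = act2 g k β := by
      have := wfO_nrm h'.1.2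
      refine Prod.ext (by rw [e]; rfl) ?_
      rw [← this, e, nrm_shft]; rfl
    have := h.2 _ hm
    have e3 : β'.1 = actS g k β.1 := by rw [e2]; rfl
    have e4 : β'.2 = nrm (actO g k β) := by rw [e2]; rfl
    simp only [← e3, ← e4] at this
    rw [h'.1.1, h'.1.2] at this
    exact ble_le.1 (by simpa using this)
  exact cb_inj (le_antisymm (half h h' hI) (half h' h hI.symm))

theorem exists_min (P : Bet → Prop) (h : ∃ β, P β) : ∃ β, P β ∧ ∀ β', P β' → cb β ≤ cb β' := by
  obtain ⟨β, hβ, hm⟩ := (InvImage.wf cb Nat.lt_wfRel.wf).has_min {β | P β} h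
  exact ⟨β, hβ, fun β' h' => not_lt.1 (hm β' h')⟩

theorem exists_canon1 {B : Type*} {L : LeftBrace B}
    (hr : ∀ β, L.Iso (MB false β (wfF β)) → rk β.1 = true)
    (h : ∃ β, L.Iso (MB false β (wfF β))) :
    ∃ β, canon1 β = true ∧ L.Iso (MB false β (wfF β)) := by
  obtain ⟨β, hβ, hm⟩ := exists_min (fun β => L.Iso (MB false β (wfF β))) h
  have key : ∀ p ∈ glL, cb β ≤ cb (act p.1 p.2 β) := by
    intro p hp
    obtain ⟨h1, h2⟩ := of_glL hp
    refine hm _ (hβ.trans (iso_act _ _ h1 h2 false false (fun h => by cases h) ?_).symm)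
    rw [Bool.and_false, shft_false]
  refine ⟨β, ?_, hβ⟩
  simp only [canon1, smin, omin, foM_eq, foS_eq, foO_eq, Bool.and_eq_true, List.all_eq_true, ble_le]
  refine ⟨⟨hr β hβ, fun p hp => ?_⟩, fun p hp => ?_⟩
  · have k := key p hp
    have q1 := cm_lt β.2
    have q2 := cm_lt (act p.1 p.2 β).2
    simp only [cb] at k
    change cm β.1 ≤ cm (act p.1 p.2 β).1
    omega
  · obtain ⟨hp1, hp2⟩ := mem_cen.1 hp
    have k := key p hp1
    have e : (act p.1 p.2 β).1 = β.1 := hp2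
    simp only [cb, e] at k
    change cm β.2 ≤ cm (act p.1 p.2 β).2
    omega

theorem exists_canon2 {B : Type*} {L : LeftBrace B}
    (hr : ∀ β w, L.Iso (MB true β w) → rk β.1 = true)
    (h : ∃ β w, L.Iso (MB true β w)) :
    ∃ β, ∃ hc : canon2 β = true, L.Iso (MB true β (canon2_Wf hc)) := by
  obtain ⟨β, hβ, hm⟩ := exists_min
    (fun β => ∃ w, L.Iso (MB true β w) ∧ wfO β.2 = true) (by
      obtain ⟨β, w, hI⟩ := h
      obtain ⟨k1, k2⟩ := of_Wf w (hr β w hI)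
      have w' : Wf true (β.1, nrm β.2) := Wf_of k1 k2
      refine ⟨(β.1, nrm β.2), w', hI.trans (LeftBrace.Iso.symm ?_), k2⟩
      obtain ⟨a, b, e⟩ := shft_nrm β
      refine iso_act (g := one3) (h := one3) w w' (by decide) (by decide) a b
        (fun _ => by decide) ?_
      rw [Bool.true_and, Bool.true_and, act_one, e])
  obtain ⟨w, hI, ho⟩ := hβ
  have hs := (of_Wf w (hr β w hI)).1
  have hc : canon2 β = true := by
    simp only [canon2, ok2, foM_eq, foS_eq, foO_eq, Bool.and_eq_true, List.all_eq_true]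
    refine ⟨⟨hs, ho⟩, fun p hp => ?_⟩
    change (!wfS (act2 p.1 p.2 β).1 || (!wfO (act2 p.1 p.2 β).2 ||
      Nat.ble (cb β) (cb (act2 p.1 p.2 β)))) = true
    cases hw1 : wfS (act2 p.1 p.2 β).1 with
    | false => rfl
    | true =>
    cases hw2 : wfO (act2 p.1 p.2 β).2 with
    | false => rfl
    | true =>
      have w' := Wf_of hw1 hw2
      rw [Bool.not_true, Bool.false_or, Bool.false_or, ble_le]
      refine hm _ ⟨w', hI.trans (LeftBrace.Iso.symm ?_), hw2⟩
      obtain ⟨h1, h2⟩ := of_glL (glL_of_gl8 hp)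
      obtain ⟨a, b, e⟩ := shft_nrm (act p.1 p.2 β)
      exact iso_act w w' h1 h2 a b (fun _ => of_gl8 hp) e
  exact ⟨β, hc, hI⟩

theorem MB_not_iso {β β' : Bet} (w : Wf true β) (w' : Wf false β')
    (hI : (MB true β w).Iso (MB false β' w')) : False := by
  obtain ⟨f, g, h, D⟩ := exists_isoData w w' hI
  exact Bool.noConfusion (iso_s D rfl)

/-! ### Counting -/

theorem card_subtype_list {α : Type*} (l : List α) (hl : l.Nodup) (hm : ∀ x, x ∈ l)
    (p : α → Bool) : Nat.card {x // p x = true} = l.countP p := by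
  classical
  rw [List.countP_eq_length_filter, ← List.toFinset_card_of_nodup (hl.filter p)]
  rw [← Nat.card_eq_finsetCard]
  refine Nat.card_congr (Equiv.subtypeEquivRight fun x => ?_)
  simp [hm]

theorem sum_filter_aux {α γ : Type*} (l : List α) (M : List γ) (P : α → Bool) (Q : α → γ → Bool) :
    (l.map fun s => M.countP fun o => P s && Q s o).sum =
      ((l.filter P).map fun s => M.countP (Q s)).sum := by
  induction l with
  | nil => rfl
  | cons a l ih =>
    rw [List.map_cons, List.sum_cons, ih, List.filter_cons]
    cases P a <;> simp

theorem card_pairs (P : M3 → Bool) (Q : M3 → M3 → Bool) :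
    Nat.card {β : Bet // (P β.1 && Q β.1 β.2) = true} =
      ((allM.filter P).map fun s => allM.countP (Q s)).sum := by
  rw [card_subtype_list (allM ×ˢ allM) (nodup_allM.product nodup_allM)
    (fun x => List.mem_product.2 ⟨mem_allM _, mem_allM _⟩) (fun β => P β.1 && Q β.1 β.2)]
  rw [← sum_filter_aux]
  change List.countP _ (List.product _ _) = _
  rw [List.product, List.countP_flatMap]
  congr 1
  refine List.map_congr_left fun s _ => ?_
  rw [Function.comp, List.countP_map]; rfl

theorem card_canon1 : Nat.card {β : Bet // canon1 β = true} = cnt1 :=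
  card_pairs smin (fun s o => omin (cen s) s o)

theorem card_canon2 : Nat.card {β : Bet // canon2 β = true} = cnt2 := by
  have := card_pairs wfS (fun s o => wfO o && ok2 gl8 (s, o))
  simp only [canon2, Bool.and_assoc]
  refine this.trans ?_
  simp only [cnt2]
  congr 1
  refine List.map_congr_left fun s _ => ?_
  rw [List.countP_filter]
  congr 1; funext o; rw [Bool.and_comm]


/-! ### The additive group -/

abbrev A16 : Type := ZMod 2 × ZMod 2 × ZMod 4 × ZMod 4

/-- the additive group of a left brace -/
def LeftBrace.Ad {B : Type*} (_ : LeftBrace B) : Type _ := B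

instance {B : Type*} (L : LeftBrace B) : Add L.Ad := ⟨L.add⟩
instance {B : Type*} (L : LeftBrace B) : Zero L.Ad := ⟨L.zero⟩
instance {B : Type*} (L : LeftBrace B) : Neg L.Ad := ⟨L.neg⟩

instance {B : Type*} (L : LeftBrace B) : AddCommGroup L.Ad where
  add_assoc := L.add_assoc
  add_comm := L.add_comm
  zero_add := L.zero_add
  add_zero a := (L.add_comm a L.zero).trans (L.zero_add a)
  neg_add_cancel := L.neg_add_cancel
  nsmul := nsmulRec
  zsmul := zsmulRec

theorem LeftBrace.AddIso.of_iso {B₁ B₂ : Type*} {L₁ : LeftBrace B₁} {L₂ : LeftBrace B₂}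
    {A : Type*} [AddGroup A] (h : L₁.AddIso A) (k : L₂.Iso L₁) : L₂.AddIso A := by
  obtain ⟨e, he⟩ := h
  obtain ⟨f, fa, -⟩ := k
  exact ⟨f.trans e, fun x y => by simp only [Equiv.trans_apply, fa, he]⟩

theorem LeftBrace.MulIso.of_iso {B₁ B₂ : Type*} {L₁ : LeftBrace B₁} {L₂ : LeftBrace B₂}
    {A : Type*} [AddGroup A] (h : L₁.MulIso A) (k : L₂.Iso L₁) : L₂.MulIso A := by
  obtain ⟨e, he⟩ := h
  obtain ⟨f, -, fm⟩ := k
  exact ⟨f.trans e, fun x y => by simp only [Equiv.trans_apply, fm, he]⟩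

theorem red_hlf_bij : Function.Bijective (fun x : G4 => (red x, hlf x)) := by
  rw [Fintype.bijective_iff_injective_and_card]
  refine ⟨fun x y h => ?_, by decide⟩
  have inj : ∀ m n : ZMod 4, par m = par n → hb m = hb n → m = n := by decide
  have h1 : red x = red y := congrArg Prod.fst h
  have h2 : hlf x = hlf y := congrArg Prod.snd h
  exact Prod.ext (inj _ _ (congrArg (fun v : V3 => v.1) h1) (congrArg (fun v : V3 => v.1) h2))
    (Prod.ext
      (inj _ _ (congrArg (fun v : V3 => v.2.1) h1) (congrArg (fun v : V3 => v.2.1) h2))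
      (inj _ _ (congrArg (fun v : V3 => v.2.2) h1) (congrArg (fun v : V3 => v.2.2) h2)))

theorem card_red (P : V3 → Prop) : Nat.card {x : G4 // P (red x)} = Nat.card {v // P v} * 8 := by
  have e1 : {x : G4 // P (red x)} ≃ {p : V3 × V3 // P p.1} :=
    (Equiv.ofBijective _ red_hlf_bij).subtypeEquiv (fun x => Iff.rfl)
  have e2 : {p : V3 × V3 // P p.1} ≃ {v // P v} × V3 := Equiv.prodSubtypeFstEquivSubtypeProd
  rw [Nat.card_congr (e1.trans e2), Nat.card_prod]
  congr 1
  rw [Nat.card_eq_fintype_card]; decide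

theorem rk_of_addIso {s : Bool} {β : Bet} (w : Wf s β) (h : (MB s β w).AddIso A16) :
    rk β.1 = true := by
  obtain ⟨e, he⟩ := h
  have he : ∀ x y, e (oplus s β x y) = e x + e y := he
  have e0 : e 0 = 0 := by
    have := he 0 0
    rw [oplus_zero] at this
    exact left_eq_add.mp this
  have c1 : Nat.card {a : A16 // a + a = 0} = 16 := by
    rw [Nat.card_eq_fintype_card]; decide
  have c2 : Nat.card {x : G4 // eqV (ap β.1 (red x)) (red x) = true} = 16 := by
    rw [← c1]
    refine Nat.card_congr (e.subtypeEquiv fun x => ?_)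
    rw [← he, ← e0, e.apply_eq_iff_eq, oplus_self, ← dbl_zero, eqV_iff]
    constructor
    · intro h; rw [h, V3.add_self]
    · intro h; exact (v_eq_iff.2 (dbl_inj h)).symm
  rw [card_red (fun v => eqV (ap β.1 v) v = true),
    card_subtype_list allV (by decide) mem_allV (fun v => eqV (ap β.1 v) v)] at c2
  rw [rk, Nat.beq_eq]
  omega

def indp (m : M3) : Bool := foM m fun m => allV.all fun v => eqV v (false, false, false) ||
  fo (ap m v) fun w => !eqV w (false, false, false)

theorem indp_iff {m : M3} (h : indp m = true) (v : V3) (hv : ap m v = 0) : v = 0 := by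
  simp only [indp, foM_eq, fo_eq, List.all_eq_true] at h
  have := h v (mem_allV v)
  rw [hv] at this
  rcases Bool.or_eq_true_iff.1 this with h | h
  · exact eqV_iff.1 h
  · exact absurd h (by decide)

theorem rk_aux : (allM.all fun S => foM S fun S => !rk S || allV.any fun k => fo k fun k =>
    eqV (ap S k) k && allV.any fun f => fo f fun f => !eqV f k && allV.any fun f' => fo f' fun f' =>
    indp (k, f, f') && allV.any fun e => indp (e, vadd f (ap S f), vadd f' (ap S f'))) = true := by
  decide +kernel

theorem rk_basis {S : M3} (h : rk S = true) : ∃ k f f' e, ap S k = k ∧ indp (k, f, f') = true ∧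
    indp (e, f + ap S f, f' + ap S f') = true := by
  have h1 := List.all_eq_true.1 rk_aux S (mem_allM S)
  simp only [foM_eq, fo_eq, h, List.any_eq_true, Bool.and_eq_true, Bool.not_true,
    Bool.false_or] at h1
  obtain ⟨k, -, hk, f, -, -, f', -, hi, e, -, he⟩ := h1
  exact ⟨k, f, f', e, eqV_iff.1 hk, hi, he⟩

section
variable {A : Type*} [AddCommGroup A]

def cnd (b : Bool) (c : A) : A := cond b c 0

def hom2 (c : A) (h : c + c = 0) : ZMod 2 →+ A :=
  ZMod.lift 2 ⟨zmultiplesHom A c, by simpa [two_zsmul] using h⟩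

def hom4 (c : A) (h : c + c + (c + c) = 0) : ZMod 4 →+ A :=
  ZMod.lift 4 ⟨zmultiplesHom A c, by
    rw [zmultiplesHom_apply, ← h]
    have : ((4 : ℕ) : ℤ) = 2 + 2 := by norm_num
    rw [this, add_zsmul, two_zsmul]⟩

theorem hom2_one (c : A) (h : c + c = 0) : hom2 c h 1 = c := by
  have := ZMod.lift_coe 2 ⟨zmultiplesHom A c, by simpa [two_zsmul] using h⟩ 1
  simpa [hom2] using this

theorem hom4_one (c : A) (h : c + c + (c + c) = 0) : hom4 c h 1 = c := by
  have := ZMod.lift_coe 4 ⟨zmultiplesHom A c, by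
    rw [zmultiplesHom_apply, ← h]
    have : ((4 : ℕ) : ℤ) = 2 + 2 := by norm_num
    rw [this, add_zsmul, two_zsmul]⟩ 1
  simpa [hom4] using this

theorem zmod2_cases (i : ZMod 2) : ∃ b : Bool, i = cond b 1 0 := by revert i; decide
theorem zmod4_cases (i : ZMod 4) : ∃ a b : Bool, i = lf a + db b := by revert i; decide

theorem hom2_cnd (c : A) (h : c + c = 0) (b : Bool) : hom2 c h (cond b 1 0) = cnd b c := by
  cases b
  · exact map_zero _
  · exact hom2_one c h

theorem hom4_cnd (c : A) (h : c + c + (c + c) = 0) (a b : Bool) :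
    hom4 c h (lf a + db b) = cnd a c + cnd b (c + c) := by
  rw [map_add]
  congr 1
  · cases a
    · exact map_zero _
    · exact hom4_one c h
  · cases b
    · exact map_zero _
    · have : db true = 1 + 1 := by decide
      rw [this, map_add, hom4_one]; rfl

end

theorem addIso_of_hom {B : Type*} (L : LeftBrace B) {A : Type*} [AddGroup A] (φ : A →+ L.Ad)
    (h : Function.Bijective φ) : L.AddIso A :=
  ⟨(AddEquiv.ofBijective φ h).symm.toEquiv, map_add (AddEquiv.ofBijective φ h).symm⟩

theorem red_oplus (s : Bool) (β : Bet) (x y : G4) : red (oplus s β x y) = red x + red y := by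
  rw [oplus, red_add, red_add, red_dbl, add_zero]

theorem addIso_of_rk {s : Bool} {β : Bet} (w : Wf s β) (h : rk β.1 = true) :
    (MB s β w).AddIso A16 := by
  obtain ⟨k, f, f', e, hk, h1, h2⟩ := rk_basis h
  let L := MB s β w
  have hself : ∀ x : L.Ad, x + x = dbl (red x + ap β.1 (red x)) := oplus_self s β
  let rr : L.Ad →+ V3 :=
    { toFun := red
      map_zero' := red_zero
      map_add' := red_oplus s β }
  let dd : V3 →+ L.Ad :=
    { toFun := dbl
      map_zero' := dbl_zero
      map_add' := fun u v => (oplus_dbl_dbl u v).symm }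
  have hself' : ∀ x : L.Ad, x + x = dd (rr x + ap β.1 (rr x)) := hself
  have rd : ∀ v, rr (dd v) = 0 := red_dbl
  have ck : ∀ v : V3, ∃ c : L.Ad, rr c = v := fun v => ⟨lft v, red_lft v⟩
  obtain ⟨c1, r1⟩ := ck k
  obtain ⟨c3, r3⟩ := ck f
  obtain ⟨c4, r4⟩ := ck f'
  have q1 : c1 + c1 = 0 := by rw [hself', r1, hk, V3.add_self, map_zero]
  have q2 : dd e + dd e = 0 := by rw [← map_add, V3.add_self, map_zero]
  have q4 : ∀ c : L.Ad, c + c + (c + c) = 0 := fun c => by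
    rw [hself' c, ← map_add, V3.add_self, map_zero]
  let φ : A16 →+ L.Ad := (hom2 c1 q1).coprod ((hom2 (dd e) q2).coprod
    ((hom4 c3 (q4 c3)).coprod (hom4 c4 (q4 c4))))
  have hinj : Function.Injective φ := by
    rw [injective_iff_map_eq_zero]
    rintro ⟨i, j, a, b⟩ hx
    obtain ⟨i, rfl⟩ := zmod2_cases i
    obtain ⟨j, rfl⟩ := zmod2_cases j
    obtain ⟨a, a', rfl⟩ := zmod4_cases a
    obtain ⟨b, b', rfl⟩ := zmod4_cases b
    have hx' : cnd i c1 + (cnd j (dd e) + ((cnd a c3 + cnd a' (c3 + c3)) +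
        (cnd b c4 + cnd b' (c4 + c4)))) = 0 := by
      rw [← hom2_cnd c1 q1, ← hom2_cnd _ q2, ← hom4_cnd c3 (q4 c3), ← hom4_cnd c4 (q4 c4)]
      exact hx
    have hc : ∀ (b : Bool) (c : L.Ad), rr (cnd b c) = sm b (rr c) := by
      intro b c
      cases b
      · exact map_zero rr
      · rfl
    have hcd : ∀ (b : Bool) (v : V3), cnd b (dd v) = dd (sm b v) := by
      intro b c
      cases b
      · exact (map_zero dd).symm
      · rfl
    rw [hself' c3, hself' c4, r3, r4] at hx'
    have t1 := congrArg rr hx'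
    simp only [map_add rr, hc, rd, r1, r3, r4, map_zero] at t1
    have s0 : ∀ b, sm b 0 = 0 := by decide
    simp only [s0, zero_add, add_zero] at t1
    have t2 := indp_iff h1 (i, a, b) (show sm i k + sm a f + sm b f' = 0 by rw [add_assoc]; exact t1)
    have i0 : i = false := congrArg (fun v : V3 => v.1) t2
    have a0 : a = false := congrArg (fun v : V3 => v.2.1) t2
    have b0 : b = false := congrArg (fun v : V3 => v.2.2) t2
    subst i0 a0 b0
    have z : ∀ c : L.Ad, cnd false c = 0 := fun _ => rfl
    simp only [z, zero_add, hcd, ← map_add dd] at hx'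
    have t3 : sm j e + (sm a' (f + ap β.1 f) + sm b' (f' + ap β.1 f')) = 0 :=
      dbl_inj (hx'.trans dbl_zero.symm)
    have t4 := indp_iff h2 (j, a', b') (show sm j e + sm a' (f + ap β.1 f) + sm b' (f' + ap β.1 f') = 0 by
      rw [add_assoc]; exact t3)
    have j0 : j = false := congrArg (fun v : V3 => v.1) t4
    have a0 : a' = false := congrArg (fun v : V3 => v.2.1) t4
    have b0 : b' = false := congrArg (fun v : V3 => v.2.2) t4
    subst j0 a0 b0
    decide
  have hbij : Function.Bijective φ := by
    let ψ : A16 → G4 := φ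
    have : Function.Bijective ψ := by
      rw [Fintype.bijective_iff_injective_and_card]
      exact ⟨hinj, by decide⟩
    exact this
  exact addIso_of_hom L φ hbij


/-! ### From braces to radical rings -/

/-- the radical ring of a left brace with commutative multiplicative group -/
def LeftBrace.Rg {B : Type*} (L : LeftBrace B) (_ : ∀ x y, L.mul x y = L.mul y x) : Type _ := L.Ad

section Rg
variable {B : Type*} (L : LeftBrace B) (hc : ∀ x y, L.mul x y = L.mul y x)

instance : AddCommGroup (L.Rg hc) := inferInstanceAs (AddCommGroup L.Ad)

def LeftBrace.ci (x y : L.Rg hc) : L.Rg hc := L.mul x y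

instance : Mul (L.Rg hc) := ⟨fun x y => L.ci hc x y - x - y⟩

theorem Rg.mul_def (x y : L.Rg hc) : x * y = L.ci hc x y - x - y := rfl
theorem Rg.ci_eq (x y : L.Rg hc) : L.ci hc x y = x + y + x * y := by
  rw [Rg.mul_def]; abel
theorem Rg.ci_comm (x y : L.Rg hc) : L.ci hc x y = L.ci hc y x := hc x y
theorem Rg.ci_assoc (x y z : L.Rg hc) :
    L.ci hc (L.ci hc x y) z = L.ci hc x (L.ci hc y z) := L.mul_assoc x y z
theorem Rg.brace (x y z : L.Rg hc) :
    L.ci hc x (y + z) = L.ci hc x y + -x + L.ci hc x z := L.brace x y z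

theorem Rg.ci_zero (x : L.Rg hc) : L.ci hc x 0 = x := by
  have := Rg.brace L hc x 0 0
  rw [add_zero, add_assoc, left_eq_add, neg_add_eq_zero] at this
  exact this.symm

theorem Rg.mul_add' (x y z : L.Rg hc) : x * (y + z) = x * y + x * z := by
  rw [Rg.mul_def, Rg.mul_def, Rg.mul_def, Rg.brace]; abel

theorem Rg.mul_comm' (x y : L.Rg hc) : x * y = y * x := by
  rw [Rg.mul_def, Rg.mul_def, Rg.ci_comm]; abel

instance : NonUnitalCommRing (L.Rg hc) :=
  { (inferInstance : AddCommGroup (L.Rg hc)), (inferInstance : Mul (L.Rg hc)) with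
    left_distrib := Rg.mul_add' L hc
    right_distrib := fun x y z => by
      rw [Rg.mul_comm' L hc (x + y), Rg.mul_add', Rg.mul_comm' L hc z, Rg.mul_comm' L hc z]
    zero_mul := fun x => by
      rw [Rg.mul_comm', Rg.mul_def, Rg.ci_zero]; abel
    mul_zero := fun x => by
      rw [Rg.mul_def, Rg.ci_zero]; abel
    mul_assoc := fun x y z => by
      have h := Rg.ci_assoc L hc x y z
      simp only [Rg.ci_eq] at h
      rw [Rg.mul_comm' L hc (x + y + x * y) z] at h
      simp only [Rg.mul_add'] at h
      rw [Rg.mul_comm' L hc (x * y) z]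
      rw [Rg.mul_comm' L hc z x, Rg.mul_comm' L hc z y] at h
      have e1 : x + y + x * y + z + (x * z + y * z + z * (x * y)) =
        (x + y + z + x * y + x * z + y * z) + z * (x * y) := by abel
      have e2 : x + (y + z + y * z) + (x * y + x * z + x * (y * z)) =
        (x + y + z + x * y + x * z + y * z) + x * (y * z) := by abel
      rw [e1, e2] at h
      exact add_left_cancel h
    mul_comm := Rg.mul_comm' L hc }

abbrev Sg : Type _ := Unitization ℤ (L.Rg hc)

def Ig : @Ideal (Sg L hc) CommRing.toCommSemiring.toSemiring :=
  RingHom.ker (Unitization.fstHom ℤ (L.Rg hc)).toRingHom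

theorem mem_Ig {x : Sg L hc} : x ∈ Ig L hc ↔ ∃ r : L.Rg hc, x = r := by
  rw [Ig, RingHom.mem_ker]
  constructor
  · intro h
    refine ⟨x.snd, ?_⟩
    have h : x.fst = 0 := h
    ext
    · simp [h]
    · simp
  · rintro ⟨r, rfl⟩
    exact Unitization.fst_inr ℤ r

theorem inr_mem (r : L.Rg hc) : (r : Sg L hc) ∈ Ig L hc := (mem_Ig L hc).2 ⟨r, rfl⟩

theorem two_inr (r : L.Rg hc) : 2 * (r : Sg L hc) = ((r + r : L.Rg hc) : Sg L hc) := by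
  rw [two_mul, Unitization.inr_add]

theorem four_inr (r : L.Rg hc) : 4 * (r : Sg L hc) = ((r + r + (r + r) : L.Rg hc) : Sg L hc) := by
  rw [Unitization.inr_add, Unitization.inr_add]; ring

theorem inr_eq {r s : L.Rg hc} : (r : Sg L hc) = s ↔ r = s := Unitization.inr_injective.eq_iff
theorem inr_eq0 {r : L.Rg hc} : (r : Sg L hc) = 0 ↔ r = 0 := by
  rw [← Unitization.inr_zero ℤ, inr_eq]

theorem th_inr (r : L.Rg hc) :
    2 * (r : Sg L hc) + r * r = ((L.ci hc r r : L.Rg hc) : Sg L hc) := by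
  rw [two_inr, ← Unitization.inr_mul, ← Unitization.inr_add, Rg.ci_eq]

theorem U_card {e : L.Rg hc ≃ A16} (he : ∀ x y, e (x + y) = e x + e y) :
    {u : L.Rg hc | ∃ y, u = y + y}.ncard = 4 := by
  have h : {u : L.Rg hc | ∃ y, u = y + y} = e.symm '' {a : A16 | ∃ b, a = b + b} := by
    ext u
    constructor
    · rintro ⟨y, rfl⟩
      exact ⟨e (y + y), ⟨e y, he y y⟩, e.symm_apply_apply _⟩
    · rintro ⟨a, ⟨b, rfl⟩, rfl⟩
      refine ⟨e.symm b, ?_⟩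
      rw [Equiv.symm_apply_eq, he, Equiv.apply_symm_apply]
  rw [h, Set.ncard_image_of_injective _ e.symm.injective]
  have : {a : A16 | ∃ b, a = b + b} = ((Finset.univ.image fun b : A16 => b + b : Finset A16) : Set A16) := by
    ext a; simp [eq_comm]
  rw [this, Set.ncard_coe_finset]; decide +kernel

theorem Q_card {e : L.Rg hc ≃ G4} (he : ∀ x y, e (L.ci hc x y) = e x + e y) (e0 : e 0 = 0) :
    {q : L.Rg hc | L.ci hc q q = 0}.ncard = 8 := by
  have h : {q : L.Rg hc | L.ci hc q q = 0} = e.symm '' {a : G4 | a + a = 0} := by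
    ext u
    constructor
    · intro hu
      have hu : L.ci hc u u = 0 := hu
      exact ⟨e u, (show e u + e u = 0 by rw [← he, hu, e0]), e.symm_apply_apply _⟩
    · rintro ⟨a, ha, rfl⟩
      change L.ci hc (e.symm a) (e.symm a) = 0
      rw [← e.apply_eq_iff_eq, he, Equiv.apply_symm_apply, e0]
      exact ha
  rw [h, Set.ncard_image_of_injective _ e.symm.injective]
  have : {a : G4 | a + a = 0} = ((Finset.univ.filter fun b : G4 => b + b = 0 : Finset G4) : Set G4) := by
    ext a; simp
  rw [this, Set.ncard_coe_finset]; decide +kernel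

theorem e_zero {e : L.Rg hc ≃ G4} (he : ∀ x y, e (L.ci hc x y) = e x + e y) : e 0 = 0 := by
  have := he 0 0
  rw [Rg.ci_zero] at this
  exact left_eq_add.mp this

theorem hU_aux0 : ∀ x1 x2 y1 y2 w1 w2 : Bool,
    ¬ (db x1 = 0 ∧ db x2 = 0) → ¬ (db y1 = 0 ∧ db y2 = 0) → ¬ (db x1 = db y1 ∧ db x2 = db y2) →
    (db w1 = 0 ∧ db w2 = 0) ∨ (db w1 = db x1 ∧ db w2 = db x2) ∨ (db w1 = db y1 ∧ db w2 = db y2) ∨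
    (db w1 = db x1 + db y1 ∧ db w2 = db x2 + db y2) := by
  intro x1 x2 y1 y2 w1 w2
  cases x1 <;> cases x2 <;> cases y1 <;> cases y2 <;> cases w1 <;> cases w2 <;> decide

theorem hU_aux (x y w : ZMod 4 × ZMod 4) : x + x ≠ 0 → y + y ≠ 0 → x + x ≠ y + y →
    w + w = 0 ∨ w + w = x + x ∨ w + w = y + y ∨ w + w = (x + x) + (y + y) := by
  have := hU_aux0 (par x.1) (par x.2) (par y.1) (par y.2) (par w.1) (par w.2)
  simp only [← db_add_self] at this
  simpa only [Prod.ext_iff, Ne, Prod.fst_add, Prod.snd_add, Prod.fst_zero, Prod.snd_zero] using this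

theorem RH_Ig {e : L.Rg hc ≃ G4} (he : ∀ x y, e (L.ci hc x y) = e x + e y)
    {f : L.Rg hc ≃ A16} (hf : ∀ x y, f (x + y) = f x + f y) : RH (Ig L hc) := by
  have e0 := e_zero L hc he
  have f0 : f 0 = 0 := by
    have := hf 0 0
    rw [add_zero] at this
    exact left_eq_add.mp this
  have k4 : ∀ r : L.Rg hc, r + r + (r + r) = 0 := by
    intro r
    rw [← f.apply_eq_iff_eq, hf, hf, f0]
    generalize f r = a
    obtain ⟨i, j, k, l⟩ := a
    have h2 : ∀ i : ZMod 2, i + i + (i + i) = 0 := by decide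
    have h4 : ∀ i : ZMod 4, i + i + (i + i) = 0 := by decide
    exact Prod.ext (h2 i) (Prod.ext (h2 j) (Prod.ext (h4 k) (h4 l)))
  have kQ : ∀ x : L.Rg hc, L.ci hc x x = 0 ↔ ∃ y, x = L.ci hc y y := by
    intro x
    constructor
    · intro h
      have h1 : e x + e x = 0 := by rw [← he, h, e0]
      refine ⟨e.symm (lft (hlf (e x))), ?_⟩
      rw [← e.apply_eq_iff_eq, he, Equiv.apply_symm_apply, add_self_G, red_lft, dbl_hlf h1]
    · rintro ⟨y, rfl⟩
      rw [← e.apply_eq_iff_eq, he, he, e0, add_self_G (e y), dbl_add_self]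
  have kU : ∀ x y w : L.Rg hc, x + x ≠ 0 → y + y ≠ 0 → x + x ≠ y + y →
      w + w = 0 ∨ w + w = x + x ∨ w + w = y + y ∨ w + w = (x + x) + (y + y) := by
    intro x y w
    simp only [Ne, ← f.apply_eq_iff_eq, hf, f0]
    generalize f x = x'
    generalize f y = y'
    generalize f w = w'
    obtain ⟨i1, j1, k1⟩ := x'
    obtain ⟨i2, j2, k2⟩ := y'
    obtain ⟨i3, j3, k3⟩ := w'
    have h2 : ∀ i : ZMod 2, i + i = 0 := by decide
    have := hU_aux k1 k2 k3
    simpa only [Prod.mk_add_mk, h2, Prod.mk.injEq, Prod.mk_eq_zero, true_and, add_zero, Ne]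
      using this
  have k0 : ∀ x y : L.Rg hc, x * y = y → y = 0 := by
    intro x y h
    have h1 : L.ci hc (-x) y = L.ci hc (-x) 0 := by
      rw [Rg.ci_zero, Rg.ci_eq, neg_mul, h]; abel
    have h2 := congrArg e h1
    rw [he, he] at h2
    exact e.injective (add_left_cancel h2)
  have kz : ∃ z : L.Rg hc, L.ci hc z z = 0 ∧ (∀ y, z ≠ y + y) ∧
      ∀ q, L.ci hc q q = 0 → (∃ y, q = y + y) ∨ (∃ y, q = z + (y + y)) := by
    have cU := U_card L hc hf
    have cQ := Q_card L hc he e0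
    set U : Set (L.Rg hc) := {u : L.Rg hc | ∃ y, u = y + y} with hU
    set Q : Set (L.Rg hc) := {q : L.Rg hc | L.ci hc q q = 0} with hQ
    have : Finite (L.Rg hc) := Finite.of_equiv G4 e.symm
    have UQ : ∀ q ∈ Q, ∀ u ∈ U, q + u ∈ Q := by
      rintro q hq _ ⟨y, rfl⟩
      have hq : L.ci hc q q = 0 := hq
      change L.ci hc (q + (y + y)) (q + (y + y)) = 0
      rw [Rg.ci_eq] at hq ⊢
      have : q + (y + y) + (q + (y + y)) + (q + (y + y)) * (q + (y + y)) =
        (q + q + q * q) + (y + y + (y + y)) + (q * y + q * y + (q * y + q * y)) +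
        (y * y + y * y + (y * y + y * y)) := by
        simp only [mul_add, add_mul, mul_comm y q]; abel
      rw [this, hq, k4, k4, k4]; simp
    have zQ : (0 : L.Rg hc) ∈ Q := by
      change L.ci hc 0 0 = 0
      rw [Rg.ci_zero]
    obtain ⟨z, hzQ, hzU⟩ := Set.exists_mem_notMem_of_ncard_lt_ncard
      (show U.ncard < Q.ncard by omega)
    refine ⟨z, hzQ, fun y hy => hzU ⟨y, hy⟩, ?_⟩
    have sub : U ∪ (fun u => z + u) '' U ⊆ Q := by
      rintro q (hq | ⟨u, hu, rfl⟩)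
      · have := UQ 0 zQ q hq
        rwa [zero_add] at this
      · exact UQ z hzQ u hu
    have dis : Disjoint U ((fun u => z + u) '' U) := by
      rw [Set.disjoint_left]
      rintro _ ⟨y, rfl⟩ ⟨_, ⟨y', rfl⟩, h⟩
      apply hzU
      refine ⟨y - y', ?_⟩
      have h : z + (y' + y') = y + y := h
      rw [eq_sub_of_add_eq h]; abel
    have cc : (U ∪ (fun u => z + u) '' U).ncard = 8 := by
      rw [Set.ncard_union_eq dis, Set.ncard_image_of_injective _ (add_right_injective z), cU]
    have eq := Set.eq_of_subset_of_ncard_le sub (by omega)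
    intro q hq
    have hq : q ∈ U ∪ (fun u => z + u) '' U := by rw [eq]; exact hq
    rcases hq with hq | ⟨_, ⟨y, rfl⟩, h⟩
    · exact Or.inl hq
    · exact Or.inr ⟨y, h.symm⟩
  have all : ∀ P : Sg L hc → Prop, (∀ r : L.Rg hc, P r) → ∀ x ∈ Ig L hc, P x := by
    intro P h x hx
    obtain ⟨r, rfl⟩ := (mem_Ig L hc).1 hx
    exact h r
  constructor
  · refine all _ fun r => ?_
    rw [four_inr, k4, Unitization.inr_zero]
  · refine all _ fun r => all _ fun r' => ?_
    rw [← Unitization.inr_mul, inr_eq, inr_eq0]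
    exact k0 r r'
  · refine all _ fun r => ?_
    rw [th_inr, inr_eq0, kQ]
    constructor
    · rintro ⟨y, hy⟩
      exact ⟨y, inr_mem L hc y, by rw [th_inr, inr_eq]; exact hy⟩
    · rintro ⟨y, hy, h⟩
      obtain ⟨r', rfl⟩ := (mem_Ig L hc).1 hy
      rw [th_inr, inr_eq] at h
      exact ⟨r', h⟩
  · obtain ⟨z, h1, h2, h3⟩ := kz
    refine ⟨z, inr_mem L hc z, ?_, all _ fun r => ?_, all _ fun q => ?_⟩
    · rw [th_inr, h1, Unitization.inr_zero]
    · rw [two_inr, Ne, inr_eq]; exact h2 r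
    · rw [th_inr, inr_eq0]
      intro h
      rcases h3 q h with ⟨y, h⟩ | ⟨y, h⟩
      · exact Or.inl ⟨y, inr_mem L hc y, by rw [two_inr, inr_eq]; exact h⟩
      · exact Or.inr ⟨y, inr_mem L hc y, by
          rw [two_inr, ← Unitization.inr_add, inr_eq]; exact h⟩
  · refine all _ fun x => all _ fun y => all _ fun w => ?_
    simp only [two_inr, Ne, inr_eq, inr_eq0, ← Unitization.inr_add]
    exact kU x y w

/-- what we need to know about the radical ring -/
structure RD (N : L.Rg hc → Prop) (a : L.Rg hc) : Prop where
  haN : ¬ N a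
  hd : ∀ x, N x ∨ ∃ n, N n ∧ x = a + n
  h2 : ∀ x y : L.Rg hc, x * y + x * y = 0
  h3 : ∀ x y n : L.Rg hc, N n → x * y * n = 0
  h4 : a * a * a * a = 0
  ht : ∃ y, N y ∧ a * a * a = L.ci hc y y
  hadd : ∀ x y, N x → (N (x + y) ↔ N y)
  hmul : ∀ x y : L.Rg hc, N (x * y)
  hker : ∀ x y : L.Rg hc, L.ci hc (x * y) (x * y) = 0

theorem exists_RD {e : L.Rg hc ≃ G4} (he : ∀ x y, e (L.ci hc x y) = e x + e y)
    {f : L.Rg hc ≃ A16} (hf : ∀ x y, f (x + y) = f x + f y) : ∃ N a, RD L hc N a := by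
  obtain ⟨N, a, H⟩ := (RH_Ig L hc he hf).main
  obtain ⟨a, rfl⟩ := (mem_Ig L hc).1 H.ha
  have m := inr_mem L hc
  refine ⟨fun r => N r, a, H.haN, fun x => ?_, fun x y => ?_, fun x y n hn => ?_, ?_, ?_,
    fun x y hx => ?_, fun x y => ?_, fun x y => ?_⟩
  · rcases H.hd x (m x) with h | ⟨n, hn, h1, h2⟩
    · exact Or.inl h
    · obtain ⟨n, rfl⟩ := (mem_Ig L hc).1 hn
      rw [← Unitization.inr_add, inr_eq] at h2
      exact Or.inr ⟨n, h1, h2⟩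
  · have := H.h2 x (m x) y (m y)
    rwa [← Unitization.inr_mul, two_inr, inr_eq0] at this
  · have := H.h3 x (m x) y (m y) n (m n) hn
    rwa [← Unitization.inr_mul, ← Unitization.inr_mul, inr_eq0] at this
  · have := H.h4
    rwa [← Unitization.inr_mul, ← Unitization.inr_mul, ← Unitization.inr_mul, inr_eq0] at this
  · obtain ⟨y, hy, h1, h2⟩ := H.ht
    obtain ⟨y, rfl⟩ := (mem_Ig L hc).1 hy
    rw [th_inr, ← Unitization.inr_mul, ← Unitization.inr_mul, inr_eq] at h2
    exact ⟨y, h1, h2⟩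
  · have := H.hadd x (m x) y (m y) hx
    rwa [← Unitization.inr_add] at this
  · have := H.hmul x (m x) y (m y)
    rwa [← Unitization.inr_mul] at this
  · have := H.hker x (m x) y (m y)
    rwa [← Unitization.inr_mul, th_inr, inr_eq0] at this

end Rg


/-! ### The structure theorem -/

structure PD (p : G4 → G4 → V3) (l : G4 → Bool) (τ : V3) : Prop where
  comm : ∀ u v, p u v = p v u
  padd : ∀ u u' v, p (u + u') v = p u v + p u' v + sm (l u && (l u' && l v)) τ
  passoc : ∀ u v w, p (dbl (p u v)) w = sm (l u && (l v && l w)) τ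
  ladd : ∀ u u', l (u + u') = xor (l u) (l u')
  l1 : ∃ u, l u = true
  l0 : ∃ u, l u = false ∧ red u = τ

section
variable {B : Type*} {L : LeftBrace B} {hc : ∀ x y, L.mul x y = L.mul y x}

theorem RD.exists_PD {N : L.Rg hc → Prop} {a : L.Rg hc} (H : RD L hc N a)
    {e : L.Rg hc ≃ G4} (he : ∀ x y, e (L.ci hc x y) = e x + e y) :
    ∃ p l τ, PD p l τ ∧ ∀ x y : L.Rg hc, e (x + y) = e x + e y + dbl (p (e x) (e y)) := by
  classical
  have e0 := e_zero L hc he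
  have N0 : N 0 := by have := H.hmul 0 0; rwa [mul_zero] at this
  have Naa : N (a + a) := by
    rcases H.hd (a + a) with h | ⟨n, hn, h⟩
    · exact h
    · have := add_left_cancel h
      exact absurd (this ▸ hn) H.haN
  have ex : ∀ x, ¬ N x → ∃ n, N n ∧ x = a + n := fun x hx => (H.hd x).resolve_left hx
  have l_add : ∀ x y, decide (¬ N (x + y)) = xor (decide (¬ N x)) (decide (¬ N y)) := by
    intro x y
    by_cases hx : N x
    · simp only [H.hadd x y hx]; simp [hx]
    · by_cases hy : N y
      · simp only [add_comm x y, H.hadd y x hy]; simp [hy]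
      · obtain ⟨n, hn, h⟩ := ex x hx
        obtain ⟨m, hm, k⟩ := ex y hy
        have : N (x + y) := by
          have q : x + y = (a + a) + (n + m) := by rw [h, k]; abel
          rw [q, H.hadd _ _ Naa, H.hadd _ _ hn]; exact hm
        simp [this, hx, hy]
  have l_ci : ∀ x y, decide (¬ N (L.ci hc x y)) = xor (decide (¬ N x)) (decide (¬ N y)) := by
    intro x y
    rw [Rg.ci_eq, add_comm, ← l_add]
    simp only [H.hadd _ _ (H.hmul x y)]
  have tri : ∀ x y z, x * y * z =
      if (decide (¬ N x) && (decide (¬ N y) && decide (¬ N z))) = true then a * a * a else 0 := by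
    intro x y z
    by_cases hz : N z
    · rw [H.h3 x y z hz]; simp [hz]
    by_cases hy : N y
    · rw [mul_right_comm, H.h3 x z y hy]; simp [hy]
    by_cases hx : N x
    · rw [mul_assoc, mul_comm, H.h3 y z x hx]; simp [hx]
    obtain ⟨n, hn, rfl⟩ := ex x hx
    obtain ⟨m, hm, rfl⟩ := ex y hy
    obtain ⟨k, hk, rfl⟩ := ex z hz
    rw [if_pos (by simp [hx, hy, hz]), mul_add, H.h3 _ _ k hk, add_zero, mul_right_comm, mul_add,
      H.h3 _ _ m hm, add_zero, mul_assoc, mul_comm, mul_add, H.h3 _ _ n hn, add_zero]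
  have h2t : a * a * a + a * a * a = 0 := H.h2 (a * a) a
  obtain ⟨y0, hy0, ht⟩ := H.ht
  have et : e (a * a * a) = dbl (red (e y0)) := by rw [ht, he, add_self_G]
  have sq : ∀ x y z w : L.Rg hc, x * y * (z * w) = 0 := fun x y z w => H.h3 _ _ _ (H.hmul z w)
  have sum : ∀ x y : L.Rg hc, x * y = 0 → e (x + y) = e x + e y := by
    intro x y h
    rw [← he, Rg.ci_eq, h, add_zero]
  let p : G4 → G4 → V3 := fun u v => hlf (e (e.symm u * e.symm v))
  let l : G4 → Bool := fun u => decide (¬ N (e.symm u))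
  have hp : ∀ u v, dbl (p u v) = e (e.symm u * e.symm v) := by
    intro u v
    refine dbl_hlf ?_
    rw [← he, H.hker, e0]
  have es : ∀ u v, e.symm (u + v) = L.ci hc (e.symm u) (e.symm v) := by
    intro u v
    rw [Equiv.symm_apply_eq, he, Equiv.apply_symm_apply, Equiv.apply_symm_apply]
  have etri : ∀ u v w, e (e.symm u * e.symm v * e.symm w) =
      dbl (sm (l u && (l v && l w)) (red (e y0))) := by
    intro u v w
    rw [tri]
    change e (if (l u && (l v && l w)) = true then _ else _) = _
    cases (l u && (l v && l w))
    · rw [if_neg (by simp), e0, sm_false, dbl_zero]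
    · rw [if_pos rfl, et, sm_true]
  refine ⟨p, l, red (e y0), ⟨?_, ?_, ?_, ?_, ?_, ?_⟩, ?_⟩
  · intro u v
    simp only [p]; rw [mul_comm]
  · intro u u' v
    apply dbl_inj
    rw [dbl_add, dbl_add, hp, hp, hp, ← etri, es, Rg.ci_eq, add_mul, add_mul, sum, sum]
    · exact sq _ _ _ _
    · rw [add_mul, mul_assoc (e.symm u) (e.symm u'), sq, sq, add_zero]
  · intro u v w
    apply dbl_inj
    rw [hp, hp, Equiv.symm_apply_apply, etri]
  · intro u v
    simp only [l, es]; exact l_ci _ _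
  · refine ⟨e a, ?_⟩
    simp [l, H.haN]
  · refine ⟨e y0, ?_, rfl⟩
    simp [l, hy0]
  · intro x y
    rw [hp, Equiv.symm_apply_apply, Equiv.symm_apply_apply, ← he, ← he]
    congr 1
    rw [Rg.ci_eq L hc (L.ci hc x y), Rg.ci_eq, add_mul, add_mul, sq, mul_comm x (x * y), tri x y x,
      mul_comm y (x * y), tri x y y]
    have : x + y + x * y + x * y = x + y := by rw [add_assoc, H.h2, add_zero]
    rw [this]
    cases decide (¬ N x) <;> cases decide (¬ N y) <;> simp [h2t]

end

theorem add_hom_V {F : G4 → V3} (hF : ∀ x y, F (x + y) = F x + F y) (x : G4) :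
    F x = ap (F B1, F B2, F B3) (red x) := by
  have F0 : F 0 = 0 := by
    have := hF 0 0
    rw [add_zero, V3.add_self] at this; exact this
  have Fd : ∀ v, F (dbl v) = 0 := by
    intro v
    have := add_self_G (lft v)
    rw [red_lft] at this
    rw [← this, hF, V3.add_self]
  have h1 : ∀ m : ZMod 4, m = lf (par m) + db (hb m) := by decide
  have h2 : x = lft (red x) + dbl (hlf x) := Prod.ext (h1 _) (Prod.ext (h1 _) (h1 _))
  have h3 : ∀ v : V3, F (lft v) = ap (F B1, F B2, F B3) v := by
    intro v
    have k : lft v = cond v.1 B1 0 + cond v.2.1 B2 0 + cond v.2.2 B3 0 := by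
      revert v; decide
    rw [k, hF, hF]
    have k2 : ∀ b : Bool, ∀ u : G4, F (cond b u 0) = sm b (F u) := by
      intro b u; cases b
      · exact F0
      · rfl
    rw [k2, k2, k2]; rfl
  conv_lhs => rw [h2, hF, Fd, add_zero, h3]

theorem biadd_bil {q : G4 → G4 → V3} (hq : ∀ x y, q x y = q y x)
    (ha : ∀ x x' y, q (x + x') y = q x y + q x' y) :
    ∃ β, ∀ x y, q x y = bil β (red x) (red y) := by
  refine ⟨((q B1 B1, q B2 B2, q B3 B3), (q B1 B2, q B1 B3, q B2 B3)), fun x y => ?_⟩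
  have h1 : ∀ z, q x z = ap (q B1 z, q B2 z, q B3 z) (red x) := fun z =>
    add_hom_V (F := fun x => q x z) (fun x x' => ha x x' z) x
  have h2 : ∀ z, q z y = ap (q z B1, q z B2, q z B3) (red y) := fun z =>
    add_hom_V (F := fun y => q z y) (fun x x' => by simp only [hq z, ha]) y
  rw [h1, h2 B1, h2 B2, h2 B3, hq B2 B1, hq B3 B1, hq B3 B2]
  generalize red x = x
  generalize red y = y
  simp only [ap, bil, sm_xor, sm_add, sm_sm]
  abel

theorem smE1 (b : Bool) : (sm b E1).1 = b := by revert b; decide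
theorem smE2 (b : Bool) : (sm b E2).2.1 = b := by revert b; decide
theorem smE2' (b : Bool) : (sm b E2).1 = false := by revert b; decide

def dotp (c v : V3) : Bool := (ap (sm c.1 E1, sm c.2.1 E1, sm c.2.2 E1) v).1

theorem basis_aux : ∀ c τ : V3, τ ≠ 0 → (∃ v, dotp c v = true) → dotp c τ = false →
    ∃ h1 h3, dotp c h1 = true ∧ dotp c h3 = false ∧ indp (h1, τ, h3) = true := by
  decide +kernel

theorem lin_B1 (c1 c2 c3 : G4) : lin c1 c2 c3 B1 = c1 := by simp [lin, B1]
theorem lin_B2 (c1 c2 c3 : G4) : lin c1 c2 c3 B2 = c2 := by simp [lin, B2]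
theorem lin_B3 (c1 c2 c3 : G4) : lin c1 c2 c3 B3 = c3 := by simp [lin, B3]

theorem PD.main {p : G4 → G4 → V3} {l : G4 → Bool} {τ : V3} (H : PD p l τ) :
    ∃ s β, ∃ _ : Wf s β, ∃ E : G4 ≃ G4, (∀ u v, E (u + v) = E u + E v) ∧
      ∀ u v, E (oplus s β u v) = E u + E v + dbl (p (E u) (E v)) := by
  by_cases hτ : τ = 0
  · subst hτ
    have s0 : ∀ b, sm b 0 = 0 := by decide
    obtain ⟨β, hβ⟩ := biadd_bil H.comm (fun x x' y => by rw [H.padd, s0, add_zero])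
    refine ⟨false, β, wfF β, Equiv.refl _, fun _ _ => rfl, fun u v => ?_⟩
    simp only [Equiv.refl_apply, oplus, pp, hβ, Bool.false_and, sm_false, add_zero]
  · have hl : ∀ u, l u = dotp (l B1, l B2, l B3) (red u) := by
      intro u
      have := add_hom_V (F := fun u => sm (l u) E1) (fun x y => by simp only [H.ladd, sm_xor]) u
      have k := congrArg (fun v : V3 => v.1) this
      rw [smE1] at k
      exact k
    set c : V3 := (l B1, l B2, l B3)
    obtain ⟨u1, hu1⟩ := H.l1
    obtain ⟨u0, hu0, hr⟩ := H.l0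
    obtain ⟨h1, h3, d1, d3, hi⟩ := basis_aux c τ hτ ⟨red u1, by rw [← hl, hu1]⟩
      (by rw [← hr, ← hl, hu0])
    have d2 : dotp c τ = false := by rw [← hr, ← hl, hu0]
    set h : M3 := (h1, τ, h3) with hh
    have hg : mm h (adj h) = one3 := by
      rcases adj_or h with k | ⟨v, k1, k2⟩
      · exact k
      · exact absurd (indp_iff hi v k1) k2
    have gh := mm_comm_one hg
    set g := adj h
    have hc : (red (lft h1), red (lft τ), red (lft h3)) = h := by simp only [red_lft, hh]
    have bij := lin_bij (c1 := lft h1) (c2 := lft τ) (c3 := lft h3) (g := g) (by rw [hc]; exact gh)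
    let E : G4 ≃ G4 := Equiv.ofBijective _ bij
    have Eadd : ∀ u v, E (u + v) = E u + E v := lin_add _ _ _
    have Edbl : ∀ v, E (dbl v) = dbl (ap h v) := fun v => by
      have := lin_dbl (lft h1) (lft τ) (lft h3) v
      rw [hc] at this; exact this
    have lE : ∀ u, l (E u) = par u.1 := by
      intro u
      have := add_hom_V (F := fun u => sm (l (E u)) E1)
        (fun x y => by simp only [Eadd, H.ladd, sm_xor]) u
      have k1 : l (E B1) = true := by
        change l (lin _ _ _ B1) = _
        rw [lin_B1, hl, red_lft, d1]
      have k2 : l (E B2) = false := by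
        change l (lin _ _ _ B2) = _
        rw [lin_B2, hl, red_lft, d2]
      have k3 : l (E B3) = false := by
        change l (lin _ _ _ B3) = _
        rw [lin_B3, hl, red_lft, d3]
      have k := congrArg (fun v : V3 => v.1) this
      simp only [k1, k2, k3, ap, add1, sm1 (red u).1, sm1 (red u).2.1, sm1 (red u).2.2, smE1,
        Bool.and_true, Bool.and_false, Bool.xor_false] at k
      exact k
    have gτ : ap g τ = E2 := congrArg (fun m : M3 => m.2.1) gh
    let p' : G4 → G4 → V3 := fun u v => ap g (p (E u) (E v))
    have p'comm : ∀ u v, p' u v = p' v u := fun u v => by simp only [p', H.comm (E u)]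
    have p'add : ∀ u u' v, p' (u + u') v =
        p' u v + p' u' v + sm (par u.1 && (par u'.1 && par v.1)) E2 := by
      intro u u' v
      simp only [p', Eadd, H.padd, ap_add, ap_sm, gτ, lE]
    have Ep : ∀ u v, E (dbl (p' u v)) = dbl (p (E u) (E v)) := by
      intro u v
      rw [Edbl, ap_ap_of hg]
    have p'assoc : ∀ u v w, p' (dbl (p' u v)) w = sm (par u.1 && (par v.1 && par w.1)) E2 := by
      intro u v w
      change ap g (p (E (dbl (p' u v))) (E w)) = _
      rw [Ep, H.passoc, ap_sm, gτ, lE, lE, lE]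
    obtain ⟨β, hβ⟩ := biadd_bil (q := fun u v => p' u v + sm (corr u.1 v.1) E2)
      (fun x y => by simp only [p'comm x, corr_comm x.1]) (fun x x' y => by
        simp only [p'add, Prod.fst_add, corr_add, sm_xor]
        generalize sm (par x.1 && (par x'.1 && par y.1)) E2 = k
        generalize p' x y = a1
        generalize p' x' y = a2
        generalize sm (corr x.1 y.1) E2 = a3
        generalize sm (corr x'.1 y.1) E2 = a4
        have : a1 + a2 + k + (a3 + a4 + k) = a1 + a3 + (a2 + a4) + (k + k) := by abel
        rw [this, V3.add_self, add_zero])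
    have hpp : ∀ u v, pp true β u v = p' u v := by
      intro u v
      rw [pp, ← hβ, Bool.true_and, add_assoc, V3.add_self, add_zero]
    have w : Wf true β := by
      intro _ x y
      have k := p'assoc (lft x) (lft y) B1
      rw [← hpp, ← hpp, pp, red_dbl, bil_zero_left, zero_add, Bool.true_and] at k
      change sm (corr (db (pp true β (lft x) (lft y)).1) B1.1) E2 = _ at k
      rw [corr_db] at k
      have kk := congrArg (fun v : V3 => v.2.1) k
      have pb : par B1.1 = true := by decide
      simp only [smE2, pb, Bool.and_true] at kk
      rw [pp, add1, smE2', Bool.xor_false, red_lft, red_lft] at kk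
      simp only [lft, par_lf] at kk
      exact kk
    refine ⟨true, β, w, E, Eadd, fun u v => ?_⟩
    rw [oplus, Eadd, Eadd, hpp, Ep]

theorem structure_thm {B : Type*} {L : LeftBrace B} (hA : L.AddIso A16) (hM : L.MulIso G4) :
    ∃ s β, ∃ w : Wf s β, L.Iso (MB s β w) := by
  obtain ⟨f, hf⟩ := hA
  obtain ⟨e, he⟩ := hM
  have hc : ∀ x y, L.mul x y = L.mul y x := fun x y => e.injective (by rw [he, he, add_comm])
  obtain ⟨N, a, H⟩ := exists_RD L hc (e := e) he (f := f) hf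
  obtain ⟨p, l, τ, P, hp⟩ := H.exists_PD (e := e) he
  obtain ⟨s, β, w, E, h1, h2⟩ := P.main
  refine ⟨s, β, w, LeftBrace.Iso.symm ⟨E.trans e.symm, fun x y => ?_, fun x y => ?_⟩⟩
  · change e.symm (E (oplus s β x y)) = _
    rw [h2, Equiv.symm_apply_eq]
    have : ∀ x y : B, e (L.add x y) = e x + e y + dbl (p (e x) (e y)) := hp
    have := this (e.symm (E x)) (e.symm (E y))
    rw [Equiv.apply_symm_apply, Equiv.apply_symm_apply] at this
    exact this.symm
  · change e.symm (E (x + y)) = _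
    rw [h1, Equiv.symm_apply_eq, he]
    simp


/-! ### The count -/

theorem exists_fin64 {s : Bool} {β : Bet} (w : Wf s β) (hr : rk β.1 = true) :
    ∃ L : {L : LeftBrace (Fin 64) // L.AddIso A16 ∧ L.MulIso G4}, L.1.Iso (MB s β w) := by
  have hcard : Fintype.card (Fin 64) = Fintype.card G4 := by
    simp [G4, ZMod.card]
  let e : Fin 64 ≃ G4 := Fintype.equivOfCardEq hcard
  let L : LeftBrace (Fin 64) :=
    { add := fun x y => e.symm ((MB s β w).add (e x) (e y))
      zero := e.symm (MB s β w).zero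
      neg := fun x => e.symm ((MB s β w).neg (e x))
      mul := fun x y => e.symm ((MB s β w).mul (e x) (e y))
      one := e.symm (MB s β w).one
      inv := fun x => e.symm ((MB s β w).inv (e x))
      add_assoc := fun a b c => by simp only [Equiv.apply_symm_apply, (MB s β w).add_assoc]
      add_comm := fun a b => by rw [(MB s β w).add_comm]
      zero_add := fun a => by
        rw [Equiv.apply_symm_apply, (MB s β w).zero_add, Equiv.symm_apply_apply]
      neg_add_cancel := fun a => by
        rw [Equiv.apply_symm_apply, (MB s β w).neg_add_cancel]
      mul_assoc := fun a b c => by simp only [Equiv.apply_symm_apply, (MB s β w).mul_assoc]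
      one_mul := fun a => by
        rw [Equiv.apply_symm_apply, (MB s β w).one_mul, Equiv.symm_apply_apply]
      mul_one := fun a => by
        rw [Equiv.apply_symm_apply, (MB s β w).mul_one, Equiv.symm_apply_apply]
      inv_mul_cancel := fun a => by
        rw [Equiv.apply_symm_apply, (MB s β w).inv_mul_cancel]
      brace := fun x y z => by simp only [Equiv.apply_symm_apply, (MB s β w).brace] }
  have hI : L.Iso (MB s β w) :=
    ⟨e, fun x y => e.apply_symm_apply _, fun x y => e.apply_symm_apply _⟩
  have hM : (MB s β w).MulIso G4 := ⟨Equiv.refl _, fun _ _ => rfl⟩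
  exact ⟨⟨L, LeftBrace.AddIso.of_iso (addIso_of_rk w hr) hI, LeftBrace.MulIso.of_iso hM hI⟩, hI⟩

theorem canon1_rk {β : Bet} (h : canon1 β = true) : rk β.1 = true := by
  simp only [canon1, smin, foM_eq, Bool.and_eq_true] at h
  exact h.1.1

theorem canon2_rk {β : Bet} (h : canon2 β = true) : rk β.1 = true := by
  simp only [canon2, wfS, Bool.and_eq_true] at h
  exact h.1.1.2.2.2

theorem count_eq :
    Nat.card (Quot (fun (L₁ L₂ : {L : LeftBrace (Fin 64) // L.AddIso A16 ∧ L.MulIso G4}) =>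
      L₁.1.Iso L₂.1)) = cnt1 + cnt2 := by
  set X := {L : LeftBrace (Fin 64) // L.AddIso A16 ∧ L.MulIso G4}
  have hequiv : Equivalence (fun (L₁ L₂ : X) => L₁.1.Iso L₂.1) :=
    ⟨fun L => LeftBrace.Iso.refl _, fun h => h.symm, fun h k => h.trans k⟩
  have qeq : ∀ {L₁ L₂ : X}, Quot.mk (fun (L₁ L₂ : X) => L₁.1.Iso L₂.1) L₁ = Quot.mk _ L₂ →
      L₁.1.Iso L₂.1 := fun h => hequiv.eqvGen_iff.1 (Quot.eqvGen_exact h)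
  choose f1 hf1 using fun b : {β : Bet // canon1 β = true} =>
    exists_fin64 (wfF b.1) (canon1_rk b.2)
  choose f2 hf2 using fun b : {β : Bet // canon2 β = true} =>
    exists_fin64 (canon2_Wf b.2) (canon2_rk b.2)
  let φ : {β : Bet // canon1 β = true} ⊕ {β : Bet // canon2 β = true} →
      Quot (fun (L₁ L₂ : X) => L₁.1.Iso L₂.1) :=
    fun b => Quot.mk _ (Sum.elim f1 f2 b)
  have hφ : Function.Bijective φ := by
    constructor
    · rintro (b | b) (b' | b') h
      · have := qeq h
        have := (hf1 b).symm.trans (this.trans (hf1 b'))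
        rw [Subtype.ext (canon1_inj b.2 b'.2 this)]
      · have := qeq h
        have := (hf1 b).symm.trans (this.trans (hf2 b'))
        exact (MB_not_iso _ _ this.symm).elim
      · have := qeq h
        have := (hf2 b).symm.trans (this.trans (hf1 b'))
        exact (MB_not_iso _ _ this).elim
      · have := qeq h
        have := (hf2 b).symm.trans (this.trans (hf2 b'))
        rw [Subtype.ext (canon2_inj b.2 b'.2 this)]
    · intro q
      obtain ⟨L, rfl⟩ := Quot.exists_rep q
      have hr : ∀ s β w, L.1.Iso (MB s β w) → rk β.1 = true := fun s β w h =>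
        rk_of_addIso w (LeftBrace.AddIso.of_iso L.2.1 h.symm)
      obtain ⟨s, β, w, hI⟩ := structure_thm L.2.1 L.2.2
      cases s
      · obtain ⟨β, hc, hI⟩ := exists_canon1 (fun β => hr false β _) ⟨β, hI⟩
        exact ⟨Sum.inl ⟨β, hc⟩, Quot.sound ((hf1 ⟨β, hc⟩).trans hI.symm)⟩
      · obtain ⟨β, hc, hI⟩ := exists_canon2 (hr true) ⟨β, w, hI⟩
        exact ⟨Sum.inr ⟨β, hc⟩, Quot.sound ((hf2 ⟨β, hc⟩).trans hI.symm)⟩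
  rw [← Nat.card_eq_of_bijective φ hφ, Nat.card_sum, card_canon1, card_canon2]

set_option maxRecDepth 100000 in
theorem cnt1_eq : cnt1 = 960 := by decide +kernel

set_option maxRecDepth 100000 in
theorem cnt2_eq : cnt2 = 94 := by decide +kernel


/-- The number of isomorphism classes of left braces with additive group
isomorphic to `C₂ × C₂ × C₄ × C₄` and multiplicative group isomorphic to
`C₄ × C₄ × C₄` is `1054`. -/
theorem number_of_braces_by_mul_group :
    Nat.card (Quot (fun (L₁ L₂ : {L : LeftBrace (Fin 64) //
        L.AddIso (ZMod 2 × ZMod 2 × ZMod 4 × ZMod 4) ∧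
        L.MulIso (ZMod 4 × ZMod 4 × ZMod 4)}) => L₁.1.Iso L₂.1)) = 1054 := by
  have h := count_eq
  rw [cnt1_eq, cnt2_eq] at h
  exact h
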